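/- arXiv:1608.06944 — 2 statements merged into one kernel-verified Lean document; each statement's English description precedes it below -/
import Mathlib

section
/- Every flow-admissible signed graph admits a nowhere-zero 12-flow. -/
open Finset

/-- A signed multigraph on vertex type `V` with edge type `E`:
each edge has an ordered pair of endpoints and a sign (`neg e = true` means negative). -/
structure SignedMultigraph (V E : Type) where
  ends : E → V × V
  neg : E → Bool

namespace SignedMultigraph

variable {V E : Type} [Fintype V] [Fintype E] [DecidableEq V] [DecidableEq E]

/-- Degree of `v` in the edge subset `F` (loops count twice). -/
def degIn (G : SignedMultigraph V E) (F : Finset E) (v : V) : ℕ :=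
  ∑ e ∈ F, ((if (G.ends e).1 = v then 1 else 0) + (if (G.ends e).2 = v then 1 else 0))

/-- Adjacency via an edge of `F`. -/
def adj (G : SignedMultigraph V E) (F : Finset E) (v w : V) : Prop :=
  ∃ e ∈ F, G.ends e = (v, w) ∨ G.ends e = (w, v)

/-- Vertices incident with an edge of `F`. -/
def supp (G : SignedMultigraph V E) (F : Finset E) : Set V :=
  {v | ∃ e ∈ F, (G.ends e).1 = v ∨ (G.ends e).2 = v}

/-- Reachability using edges of `F`. -/
def reach (G : SignedMultigraph V E) (F : Finset E) : V → V → Prop :=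
  Relation.ReflTransGen (G.adj F)

/-- `F` is (the edge set of) a circuit: nonempty, every vertex has degree 0 or 2,
and the support is connected. -/
def IsCircuit (G : SignedMultigraph V E) (F : Finset E) : Prop :=
  F.Nonempty ∧ (∀ v, G.degIn F v = 0 ∨ G.degIn F v = 2) ∧
    ∀ v ∈ G.supp F, ∀ w ∈ G.supp F, G.reach F v w

/-- The negative edges inside `F`. -/
def negEdges (G : SignedMultigraph V E) (F : Finset E) : Finset E :=
  F.filter (fun e => G.neg e = true)

def IsBalancedCircuit (G : SignedMultigraph V E) (F : Finset E) : Prop :=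
  G.IsCircuit F ∧ Even (G.negEdges F).card

def IsUnbalancedCircuit (G : SignedMultigraph V E) (F : Finset E) : Prop :=
  G.IsCircuit F ∧ Odd (G.negEdges F).card

/-- A signed graph is balanced if every circuit has an even number of negative edges. -/
def Balanced (G : SignedMultigraph V E) : Prop :=
  ∀ F : Finset E, G.IsCircuit F → Even (G.negEdges F).card

/-- `P` is the edge set of a path from `v₁` to `v₂` (trivial iff `v₁ = v₂`). -/
def IsPathBetween (G : SignedMultigraph V E) (P : Finset E) (v₁ v₂ : V) : Prop :=
  if v₁ = v₂ then P = ∅ else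
    G.degIn P v₁ = 1 ∧ G.degIn P v₂ = 1 ∧
    (∀ v, v ≠ v₁ → v ≠ v₂ → G.degIn P v = 0 ∨ G.degIn P v = 2) ∧
    ∀ v ∈ G.supp P, ∀ w ∈ G.supp P, G.reach P v w

/-- `F` is a barbell: two unbalanced circuits joined by a (possibly trivial) path. -/
def IsBarbell (G : SignedMultigraph V E) (F : Finset E) : Prop :=
  ∃ (C₁ C₂ P : Finset E) (v₁ v₂ : V),
    G.IsUnbalancedCircuit C₁ ∧ G.IsUnbalancedCircuit C₂ ∧
    G.IsPathBetween P v₁ v₂ ∧ v₁ ∈ G.supp C₁ ∧ v₂ ∈ G.supp C₂ ∧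
    F = C₁ ∪ C₂ ∪ P ∧
    (G.supp C₁ \ {v₁}) ∩ G.supp (C₂ ∪ P) = ∅ ∧
    (G.supp C₂ \ {v₂}) ∩ G.supp (C₁ ∪ P) = ∅

/-- A signed circuit is a balanced circuit or a barbell. -/
def IsSignedCircuit (G : SignedMultigraph V E) (F : Finset E) : Prop :=
  G.IsBalancedCircuit F ∨ G.IsBarbell F

/-- A bidirection `d` assigns to each half-edge a direction (`true` = toward its endpoint);
it is an orientation of the signed graph if negative edges are exactly the
extroverted/introverted ones. -/
def IsOrientation (G : SignedMultigraph V E) (d : E → Bool × Bool) : Prop :=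
  ∀ e, G.neg e = true ↔ (d e).1 = (d e).2

/-- Net inflow at vertex `v` (incoming half-edges count `+φ e`, outgoing `-φ e`). -/
def vertexSum {Γ : Type} [AddCommGroup Γ] (G : SignedMultigraph V E)
    (d : E → Bool × Bool) (φ : E → Γ) (v : V) : Γ :=
  ∑ e, ((if (G.ends e).1 = v then (if (d e).1 then φ e else -φ e) else 0) +
        (if (G.ends e).2 = v then (if (d e).2 then φ e else -φ e) else 0))

/-- `(d, φ)` is a flow: `d` is an orientation and Kirchhoff's law holds at every vertex. -/
def IsFlow {Γ : Type} [AddCommGroup Γ] (G : SignedMultigraph V E)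
    (d : E → Bool × Bool) (φ : E → Γ) : Prop :=
  G.IsOrientation d ∧ ∀ v, G.vertexSum d φ v = 0

/-- Nowhere-zero `Γ`-flow. -/
def HasNZGroupFlow (G : SignedMultigraph V E) (Γ : Type) [AddCommGroup Γ] : Prop :=
  ∃ (d : E → Bool × Bool) (φ : E → Γ), G.IsFlow d φ ∧ ∀ e, φ e ≠ 0

/-- Flow-admissible: has a nowhere-zero integer flow. -/
def FlowAdmissible (G : SignedMultigraph V E) : Prop :=
  ∃ (d : E → Bool × Bool) (φ : E → ℤ), G.IsFlow d φ ∧ ∀ e, φ e ≠ 0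

/-- Nowhere-zero `k`-flow: integer flow with `0 < |φ e| < k`. -/
def HasNZkFlow (G : SignedMultigraph V E) (k : ℤ) : Prop :=
  ∃ (d : E → Bool × Bool) (φ : E → ℤ), G.IsFlow d φ ∧ ∀ e, 0 < |φ e| ∧ |φ e| < k

/-- The flow number: least `k : ℕ` admitting a nowhere-zero `k`-flow. -/
noncomputable def flowNum (G : SignedMultigraph V E) : ℕ :=
  sInf {k : ℕ | G.HasNZkFlow (k : ℤ)}

/-- Circular `t`-flow: real flow with `1 ≤ |φ e| ≤ t - 1`. -/
def HasCircularFlow (G : SignedMultigraph V E) (t : ℝ) : Prop :=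
  ∃ (d : E → Bool × Bool) (φ : E → ℝ), G.IsFlow d φ ∧ ∀ e, 1 ≤ |φ e| ∧ |φ e| ≤ t - 1

/-- The circular flow number. -/
noncomputable def circFlowNum (G : SignedMultigraph V E) : ℝ :=
  sInf {t : ℝ | G.HasCircularFlow t}

/-- Bridgeless: the endpoints of each edge are joined by a path avoiding that edge. -/
def Bridgeless (G : SignedMultigraph V E) : Prop :=
  ∀ e : E, G.reach (Finset.univ.erase e) (G.ends e).1 (G.ends e).2

/-- Switching at a vertex `v`. -/
def switch (G : SignedMultigraph V E) (v : V) : SignedMultigraph V E where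
  ends := G.ends
  neg := fun e => xor (G.neg e) (xor (decide ((G.ends e).1 = v)) (decide ((G.ends e).2 = v)))

/-- Switching equivalence of signed graphs on the same underlying graph. -/
def Equivalent (G₁ G₂ : SignedMultigraph V E) : Prop :=
  Relation.ReflTransGen (fun H₁ H₂ => ∃ v : V, H₂ = H₁.switch v) G₁ G₂

/-- Antibalanced: switching-equivalent to an all-negative signed graph. -/
def Antibalanced (G : SignedMultigraph V E) : Prop :=
  ∃ G' : SignedMultigraph V E, G.Equivalent G' ∧ ∀ e, G'.neg e = true

/-- No vertex of the support of `S` is a source or a sink of `d` restricted to `S`. -/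
def NoSourceSink (G : SignedMultigraph V E) (d : E → Bool × Bool) (S : Finset E) : Prop :=
  ∀ v ∈ G.supp S,
    (∃ e ∈ S, ((G.ends e).1 = v ∧ (d e).1 = true) ∨ ((G.ends e).2 = v ∧ (d e).2 = true)) ∧
    (∃ e ∈ S, ((G.ends e).1 = v ∧ (d e).1 = false) ∨ ((G.ends e).2 = v ∧ (d e).2 = false))

/-- Zero-sum `k`-flow on the underlying (unsigned) graph. -/
def ZeroSumFlow (G : SignedMultigraph V E) (k : ℤ) : Prop :=
  ∃ f : E → ℤ, (∀ e, 1 ≤ |f e| ∧ |f e| ≤ k - 1) ∧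
    ∀ v : V, (∑ e, ((if (G.ends e).1 = v then f e else 0) +
                    (if (G.ends e).2 = v then f e else 0))) = 0

end SignedMultigraph

section Circulation

variable {U F : Type*} [Fintype F] [DecidableEq U]

/-- The net flow of `x` into the vertex `v` of the digraph with arcs `src f → tgt f`. -/
def netInflow (src tgt : F → U) (x : F → ℤ) (v : U) : ℤ :=
  ∑ f, x f * ((if tgt f = v then 1 else 0) - (if src f = v then 1 else 0))

/-- The largest net inflow into `S` permitted by the bounds `l ≤ x ≤ u`. -/
def cutCapacity (src tgt : F → U) (l u : F → ℤ) (S : Finset U) : ℤ :=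
  ∑ f, if tgt f ∈ S then (if src f ∈ S then 0 else u f) else (if src f ∈ S then -l f else 0)

lemma sum_netInflow (src tgt : F → U) (x : F → ℤ) (S : Finset U) :
    ∑ v ∈ S, netInflow src tgt x v =
      ∑ f, x f * ((if tgt f ∈ S then 1 else 0) - (if src f ∈ S then 1 else 0)) := by
  simp only [netInflow]
  rw [Finset.sum_comm]
  refine Finset.sum_congr rfl fun f _ => ?_
  rw [← Finset.mul_sum, Finset.sum_sub_distrib]
  simp

lemma cutCapacity_self (src tgt : F → U) (x : F → ℤ) (S : Finset U) :
    cutCapacity src tgt x x S = ∑ v ∈ S, netInflow src tgt x v := by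
  rw [sum_netInflow, cutCapacity]
  refine Finset.sum_congr rfl fun f _ => ?_
  split_ifs <;> ring

lemma cutCapacity_inter_add_union (src tgt : F → U) (l u : F → ℤ) (hlu : ∀ f, l f ≤ u f)
    (S T : Finset U) (e : F) (h₁ : tgt e ∈ S) (h₂ : src e ∉ S) (h₃ : src e ∈ T)
    (h₄ : tgt e ∉ T) :
    cutCapacity src tgt l u (S ∩ T) + cutCapacity src tgt l u (S ∪ T) + (u e - l e) ≤
      cutCapacity src tgt l u S + cutCapacity src tgt l u T := by
  classical
  have key : ∀ f, (if tgt f ∈ S ∩ T then (if src f ∈ S ∩ T then 0 else u f)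
        else (if src f ∈ S ∩ T then -l f else 0)) +
      (if tgt f ∈ S ∪ T then (if src f ∈ S ∪ T then 0 else u f)
        else (if src f ∈ S ∪ T then -l f else 0)) + (if f = e then u e - l e else 0) ≤
      (if tgt f ∈ S then (if src f ∈ S then 0 else u f) else (if src f ∈ S then -l f else 0)) +
      (if tgt f ∈ T then (if src f ∈ T then 0 else u f) else (if src f ∈ T then -l f else 0)) := by
    intro f
    have := hlu f
    by_cases hfe : f = e
    · subst hfe
      simp [h₁, h₂, h₃, h₄]
    · by_cases a : tgt f ∈ S <;> by_cases b : src f ∈ S <;> by_cases c : tgt f ∈ T <;>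
        by_cases d : src f ∈ T <;> simp [a, b, c, d, hfe] <;> linarith
  have := Finset.sum_le_sum fun f (_ : f ∈ Finset.univ) => key f
  simp only [Finset.sum_add_distrib] at this
  simpa [cutCapacity] using this

lemma cutCapacity_update_upper [DecidableEq F] (src tgt : F → U) (l u : F → ℤ) (e : F) (S : Finset U) :
    cutCapacity src tgt l (Function.update u e (u e - 1)) S =
      cutCapacity src tgt l u S - (if tgt e ∈ S ∧ src e ∉ S then 1 else 0) := by
  rw [eq_sub_iff_add_eq]
  have : (if tgt e ∈ S ∧ src e ∉ S then (1 : ℤ) else 0) =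
      ∑ f, if f = e then (if tgt e ∈ S ∧ src e ∉ S then 1 else 0) else 0 := by simp
  rw [this, cutCapacity, cutCapacity, ← Finset.sum_add_distrib]
  refine Finset.sum_congr rfl fun f _ => ?_
  by_cases hfe : f = e
  · subst hfe
    by_cases a : tgt f ∈ S <;> by_cases b : src f ∈ S <;> simp [a, b]
  · simp [hfe]

lemma cutCapacity_update_lower [DecidableEq F] (src tgt : F → U) (l u : F → ℤ) (e : F) (S : Finset U) :
    cutCapacity src tgt (Function.update l e (l e + 1)) u S =
      cutCapacity src tgt l u S - (if src e ∈ S ∧ tgt e ∉ S then 1 else 0) := by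
  rw [eq_sub_iff_add_eq]
  have : (if src e ∈ S ∧ tgt e ∉ S then (1 : ℤ) else 0) =
      ∑ f, if f = e then (if src e ∈ S ∧ tgt e ∉ S then 1 else 0) else 0 := by simp
  rw [this, cutCapacity, cutCapacity, ← Finset.sum_add_distrib]
  refine Finset.sum_congr rfl fun f _ => ?_
  by_cases hfe : f = e
  · subst hfe
    by_cases a : tgt f ∈ S <;> by_cases b : src f ∈ S <;> simp [a, b]
  · simp [hfe]

/-- Hoffman's circulation theorem with vertex demands. -/
theorem exists_netInflow_eq [Fintype U] (src tgt : F → U) (b : U → ℤ) (hb : ∑ v, b v = 0) (l u : F → ℤ)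
    (hlu : ∀ f, l f ≤ u f) (hcut : ∀ S, ∑ v ∈ S, b v ≤ cutCapacity src tgt l u S) :
    ∃ x : F → ℤ, (∀ f, l f ≤ x f ∧ x f ≤ u f) ∧ ∀ v, netInflow src tgt x v = b v := by
  classical
  induction hn : (∑ f, (u f - l f)).toNat using Nat.strong_induction_on generalizing l u with
  | _ n ih =>
  by_cases hall : ∀ f, l f = u f
  · obtain rfl : l = u := funext hall
    refine ⟨l, fun f => ⟨le_rfl, le_rfl⟩, ?_⟩
    have h₁ : ∀ v ∈ Finset.univ, b v ≤ netInflow src tgt l v := fun v _ => by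
      simpa [cutCapacity_self] using hcut {v}
    have h₂ : ∑ v, netInflow src tgt l v = 0 := by
      rw [sum_netInflow]; simp
    have h₃ := (Finset.sum_eq_sum_iff_of_le h₁).1 (by rw [hb, h₂])
    exact fun v => (h₃ v (Finset.mem_univ v)).symm
  · push Not at hall
    obtain ⟨e, he⟩ := hall
    have hlt : l e < u e := lt_of_le_of_ne (hlu e) he
    have hnonneg : ∀ f ∈ Finset.univ, 0 ≤ u f - l f := fun f _ => sub_nonneg.2 (hlu f)
    have hpos : 0 < ∑ f, (u f - l f) :=
      Finset.sum_pos' hnonneg ⟨e, Finset.mem_univ e, sub_pos.2 hlt⟩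
    by_cases h₁ : ∃ S, tgt e ∈ S ∧ src e ∉ S ∧ cutCapacity src tgt l u S ≤ ∑ v ∈ S, b v
    · by_cases h₂ : ∃ T, src e ∈ T ∧ tgt e ∉ T ∧ cutCapacity src tgt l u T ≤ ∑ v ∈ T, b v
      · obtain ⟨S, hS₁, hS₂, hS₃⟩ := h₁
        obtain ⟨T, hT₁, hT₂, hT₃⟩ := h₂
        have := cutCapacity_inter_add_union src tgt l u hlu S T e hS₁ hS₂ hT₁ hT₂
        have h₃ := hcut (S ∩ T)
        have h₄ := hcut (S ∪ T)
        have h₅ := Finset.sum_union_inter (s₁ := S) (s₂ := T) (f := b)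
        linarith
      · push Not at h₂
        obtain ⟨x, hx, hx'⟩ := ih _ (by
            rw [← hn]
            refine (Int.toNat_lt_toNat hpos).2 (Finset.sum_lt_sum (fun f _ => ?_)
              ⟨e, Finset.mem_univ e, ?_⟩)
            · by_cases hfe : f = e
              · subst hfe; simp; omega
              · simp [hfe]
            · simp) (Function.update l e (l e + 1)) u (fun f => by
            by_cases hfe : f = e
            · subst hfe; simpa using hlt
            · simpa [hfe] using hlu f) (fun S => by
            rw [cutCapacity_update_lower]
            split_ifs with h
            · have := h₂ S h.1 h.2; omega
            · simpa using hcut S) rfl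
        refine ⟨x, fun f => ⟨?_, (hx f).2⟩, hx'⟩
        have := (hx f).1
        by_cases hfe : f = e
        · subst hfe; simp at this; omega
        · simpa [hfe] using this
    · push Not at h₁
      obtain ⟨x, hx, hx'⟩ := ih _ (by
          rw [← hn]
          refine (Int.toNat_lt_toNat hpos).2 (Finset.sum_lt_sum (fun f _ => ?_)
            ⟨e, Finset.mem_univ e, ?_⟩)
          · by_cases hfe : f = e
            · subst hfe; simp
            · simp [hfe]
          · simp) l (Function.update u e (u e - 1)) (fun f => by
          by_cases hfe : f = e
          · subst hfe; simp; omega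
          · simpa [hfe] using hlu f) (fun S => by
          rw [cutCapacity_update_upper]
          split_ifs with h
          · have := h₁ S h.1 h.2; omega
          · simpa using hcut S) rfl
      refine ⟨x, fun f => ⟨(hx f).1, ?_⟩, hx'⟩
      have := (hx f).2
      by_cases hfe : f = e
      · subst hfe; simp at this; omega
      · simpa [hfe] using this

lemma dvd_cutCapacity_sub (src tgt : F → U) (k : ℤ) (b : U → ℤ) (l u : F → ℤ)
    (hmod : ∀ f, k ∣ u f - l f) (hbmod : ∀ v, k ∣ b v - netInflow src tgt l v) (S : Finset U) :
    k ∣ cutCapacity src tgt l u S - ∑ v ∈ S, b v := by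
  have h₁ : k ∣ cutCapacity src tgt l u S - cutCapacity src tgt l l S := by
    rw [cutCapacity, cutCapacity, ← Finset.sum_sub_distrib]
    refine Finset.dvd_sum fun f _ => ?_
    split_ifs <;> simp [hmod f]
  have h₂ : k ∣ ∑ v ∈ S, b v - cutCapacity src tgt l l S := by
    rw [cutCapacity_self, ← Finset.sum_sub_distrib]
    exact Finset.dvd_sum fun v _ => hbmod v
  simpa using dvd_sub h₁ h₂

/-- Hoffman's circulation theorem for flows in a prescribed residue class modulo `k`. -/
theorem exists_netInflow_eq_of_modEq [Fintype U] (src tgt : F → U) (k : ℤ) (hk : 0 < k) (b : U → ℤ)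
    (hb : ∑ v, b v = 0) (l u : F → ℤ) (hlu : ∀ f, l f ≤ u f) (hmod : ∀ f, k ∣ u f - l f)
    (hbmod : ∀ v, k ∣ b v - netInflow src tgt l v)
    (hcut : ∀ S, ∑ v ∈ S, b v ≤ cutCapacity src tgt l u S) :
    ∃ x : F → ℤ, (∀ f, l f ≤ x f ∧ x f ≤ u f ∧ k ∣ x f - l f) ∧
      ∀ v, netInflow src tgt x v = b v := by
  choose c hc using hmod
  choose d hd using hbmod
  have hsum : ∀ S : Finset U, k * ∑ v ∈ S, d v =
      ∑ v ∈ S, b v - ∑ v ∈ S, netInflow src tgt l v := fun S => by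
    rw [Finset.mul_sum, ← Finset.sum_sub_distrib]
    exact Finset.sum_congr rfl fun v _ => (hd v).symm
  obtain ⟨x, hx, hx'⟩ := exists_netInflow_eq src tgt d (by
      have h := hsum Finset.univ
      rw [hb, sum_netInflow] at h
      simpa [hk.ne'] using h) (fun _ => 0) c (fun f => by
      have := hc f
      have := hlu f
      nlinarith) (fun S => by
      refine le_of_mul_le_mul_left ?_ hk
      rw [hsum, sub_le_iff_le_add, ← cutCapacity_self, cutCapacity, Finset.mul_sum, cutCapacity,
        ← Finset.sum_add_distrib]
      refine (hcut S).trans (Finset.sum_le_sum fun f _ => ?_)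
      have := hc f
      (split_ifs <;> simp); linarith)
  refine ⟨fun f => l f + k * x f, fun f => ⟨?_, ?_, by simp⟩, fun v => ?_⟩
  · nlinarith [(hx f).1]
  · have := hc f
    nlinarith [(hx f).2]
  · have h₁ : netInflow src tgt (fun f => l f + k * x f) v =
        netInflow src tgt l v + k * netInflow src tgt x v := by
      simp only [netInflow, add_mul, Finset.sum_add_distrib, Finset.mul_sum, mul_assoc]
    rw [h₁, hx', ← hd]; ring

end Circulation

/-- A bidirected multigraph: the edge `e` has ends `s e` and `t e`, at which it carries the
signs `σ e` and `τ e`. -/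
structure BidirectedGraph (V E : Type*) where
  s : E → V
  t : E → V
  σ : E → ℤˣ
  τ : E → ℤˣ

namespace BidirectedGraph

variable {V E : Type*}

/-- The coboundary of a vertex weighting. -/
def coef {A : Type*} [CommRing A] (G : BidirectedGraph V E) (β : V → A) (e : E) : A :=
  ((G.σ e : ℤ) : A) * β (G.s e) + ((G.τ e : ℤ) : A) * β (G.t e)

/-- A positive loop, which carries any flow. -/
def Trivial (G : BidirectedGraph V E) (e : E) : Prop := G.s e = G.t e ∧ G.σ e = -G.τ e

/-- `e` has exactly one end in `S`. -/
def Crosses (G : BidirectedGraph V E) (S : Finset V) (e : E) : Prop :=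
  ¬ (G.s e ∈ S ↔ G.t e ∈ S)

variable {A : Type*} [CommRing A] (G : BidirectedGraph V E)

lemma coef_intCast (β : V → ℤ) (e : E) :
    G.coef (fun v => (β v : A)) e = ((G.coef β e : ℤ) : A) := by
  simp [coef]

variable [DecidableEq V]

/-- The signed incidence of the edge `e` with the vertex `v`. -/
def inc (G : BidirectedGraph V E) (e : E) (v : V) : ℤ :=
  (if G.s e = v then (G.σ e : ℤ) else 0) + (if G.t e = v then (G.τ e : ℤ) else 0)

/-- The boundary of an edge weighting: its net flow into each vertex. -/
def bd (A : Type*) [CommRing A] [Fintype E] (G : BidirectedGraph V E) :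
    (E → A) →ₗ[A] (V → A) where
  toFun φ v := ∑ e, φ e * (G.inc e v : A)
  map_add' φ φ' := by
    ext v; simp [add_mul, Finset.sum_add_distrib]
  map_smul' c φ := by
    ext v; simp [mul_assoc, Finset.mul_sum]

variable {G} in
lemma coef_ite_of_not_crosses {L : Finset V} {e : E} {c : V → A}
    (h : ¬ G.Crosses L e) (hc : G.s e ∈ L → G.coef c e = 0) :
    G.coef (fun v => if v ∈ L then c v else 0) e = 0 := by
  rw [Crosses, not_not] at h
  by_cases hs : G.s e ∈ L
  · simpa [coef, hs, h.1 hs] using hc hs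
  · simp [coef, hs, mt h.2 hs]

variable {G} in
lemma coef_ite_of_crosses {L : Finset V} {e : E} {c : V → A}
    (h : G.Crosses L e) (hc : ∀ v, c v = 1 ∨ c v = -1) :
    G.coef (fun v => if v ∈ L then c v else 0) e = 1 ∨
      G.coef (fun v => if v ∈ L then c v else 0) e = -1 := by
  by_cases hs : G.s e ∈ L
  · have ht : G.t e ∉ L := fun ht => h ⟨fun _ => ht, fun _ => hs⟩
    rcases hc (G.s e) with a | a <;> rcases Int.units_eq_one_or (G.σ e) with b | b <;>
      simp [coef, hs, ht, a, b]
  · have ht : G.t e ∈ L := by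
      by_contra ht
      exact h ⟨fun h => absurd h hs, fun h => absurd h ht⟩
    rcases hc (G.t e) with a | a <;> rcases Int.units_eq_one_or (G.τ e) with b | b <;>
      simp [coef, hs, ht, a, b]

lemma intCast_eq_one_or {n : ℤ} (h : n = 1 ∨ n = -1) :
    (n : A) = 1 ∨ (n : A) = -1 := by
  rcases h with rfl | rfl <;> simp

lemma inc_eq_zero {e : E} {v : V} (h₁ : G.s e ≠ v) (h₂ : G.t e ≠ v) : G.inc e v = 0 := by
  simp [inc, h₁, h₂]

lemma sum_mul_inc [Fintype V] (β : V → A) (e : E) :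
    ∑ v, β v * (G.inc e v : A) = G.coef β e := by
  simp [inc, coef, mul_add, Finset.sum_add_distrib, mul_comm]

lemma inc_of_trivial {e : E} (he : G.Trivial e) (v : V) : G.inc e v = 0 := by
  simp only [inc, he.1, he.2]
  split_ifs <;> simp

section Boundary

variable [Fintype E]

lemma bd_apply (φ : E → A) (v : V) : G.bd A φ v = ∑ e, φ e * (G.inc e v : A) := rfl

lemma sum_mul_bd [Fintype V] (β : V → A) (φ : E → A) :
    ∑ v, β v * G.bd A φ v = ∑ e, φ e * G.coef β e := by
  simp only [← sum_mul_inc, bd_apply, Finset.mul_sum]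
  rw [Finset.sum_comm]
  exact Finset.sum_congr rfl fun e _ => Finset.sum_congr rfl fun v _ => by ring

lemma bd_intCast (φ : E → ℤ) (v : V) :
    G.bd A (fun e => (φ e : A)) v = ((G.bd ℤ φ v : ℤ) : A) := by
  simp [bd_apply]

lemma bd_single [DecidableEq E] (e : E) :
    G.bd A (Pi.single e 1) =
      ((G.σ e : ℤ) : A) • Pi.single (G.s e) 1 + ((G.τ e : ℤ) : A) • Pi.single (G.t e) 1 := by
  ext v
  simp [bd_apply, Pi.single_apply, inc, eq_comm]

/-- An edge weighting restricted to a union of components of its support. -/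
lemma bd_ite_mem (Y : Finset V) (f : E → A) (h : ∀ e, f e ≠ 0 → (G.s e ∈ Y ↔ G.t e ∈ Y)) (v : V) :
    G.bd A (fun e => if G.s e ∈ Y then f e else 0) v = if v ∈ Y then G.bd A f v else 0 := by
  simp only [bd_apply]
  split_ifs with hv
  · refine Finset.sum_congr rfl fun e _ => ?_
    split_ifs with he
    · rfl
    · by_cases hf : f e = 0
      · simp [hf]
      · rw [G.inc_eq_zero (e := e) (v := v) (fun h' => he (h'.symm ▸ hv))
          (fun h' => he ((h e hf).2 (h'.symm ▸ hv)))]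
        simp
  · refine Finset.sum_eq_zero fun e _ => ?_
    split_ifs with he
    · by_cases hf : f e = 0
      · simp [hf]
      · rw [G.inc_eq_zero (e := e) (v := v) (fun h' => hv (h' ▸ he)) (fun h' => hv (h' ▸ (h e hf).1 he))]
        simp
    · simp

/-- The boundaries of the edge weightings supported on `F`. -/
def boundaries (A : Type*) [CommRing A] (G : BidirectedGraph V E) (F : Set E) :
    Submodule A (V → A) :=
  Submodule.map (G.bd A) (Submodule.pi Fᶜ fun _ => ⊥)

lemma mem_boundaries {F : Set E} {x : V → A} :
    x ∈ G.boundaries A F ↔ ∃ f : E → A, (∀ e, f e ≠ 0 → e ∈ F) ∧ G.bd A f = x := by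
  simp only [boundaries, Submodule.mem_map, Submodule.mem_pi, Submodule.mem_bot]
  exact exists_congr fun f => and_congr_left fun _ => forall_congr' fun e => by
    rw [Set.mem_compl_iff]; tauto

lemma single_mem_boundaries {F : Set E} {e : E} (he : e ∈ F) :
    ((G.σ e : ℤ) : A) • Pi.single (G.s e) (1 : A) + ((G.τ e : ℤ) : A) • Pi.single (G.t e) (1 : A) ∈
      G.boundaries A F := by
  classical
  rw [← bd_single]
  refine G.mem_boundaries.2 ⟨_, fun e' h => ?_, rfl⟩
  by_cases h' : e' = e
  · exact h' ▸ he
  · simp [h'] at h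

lemma units_mul_self_cast (κ : ℤˣ) : ((κ : ℤ) : A) * ((κ : ℤ) : A) = 1 := by
  rw [← Int.cast_mul, ← Units.val_mul, Int.units_mul_self]; simp

lemma single_sub_smul_mem_boundaries_iff {F : Set E} {e : E} (he : e ∈ F) (c : V → A) (x : V → A)
    (hc : G.coef c e = 0) :
    Pi.single (G.s e) 1 - c (G.s e) • x ∈ G.boundaries A F ↔
      Pi.single (G.t e) 1 - c (G.t e) • x ∈ G.boundaries A F := by
  have h := G.single_mem_boundaries (A := A) he
  have hσ := units_mul_self_cast (A := A) (G.σ e)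
  have hτ := units_mul_self_cast (A := A) (G.τ e)
  rw [coef] at hc
  set σ : A := ((G.σ e : ℤ) : A)
  set τ : A := ((G.τ e : ℤ) : A)
  constructor
  · intro h'
    have := Submodule.sub_mem _ (Submodule.smul_mem _ τ h) (Submodule.smul_mem _ (τ * σ) h')
    convert this using 1
    ext v
    simp only [Pi.add_apply, Pi.sub_apply, Pi.smul_apply, smul_eq_mul]
    linear_combination (c (G.t e) * x v - (Pi.single (G.t e) (1 : A) : V → A) v) * hτ
      - τ * x v * hc
  · intro h'
    have := Submodule.sub_mem _ (Submodule.smul_mem _ σ h) (Submodule.smul_mem _ (τ * σ) h')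
    convert this using 1
    ext v
    simp only [Pi.add_apply, Pi.sub_apply, Pi.smul_apply, smul_eq_mul]
    linear_combination (c (G.s e) * x v - (Pi.single (G.s e) (1 : A) : V → A) v) * hσ
      - σ * x v * hc

lemma mem_boundaries_restrict {C : Set E} {Y : Finset V}
    (hY : ∀ e ∈ C, (G.s e ∈ Y ↔ G.t e ∈ Y)) {x : V → A} (hx : x ∈ G.boundaries A C)
    (hxY : ∀ v ∉ Y, x v = 0) : x ∈ G.boundaries A {e | e ∈ C ∧ G.s e ∈ Y} := by
  obtain ⟨f, hf, rfl⟩ := G.mem_boundaries.1 hx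
  refine G.mem_boundaries.2 ⟨fun e => if G.s e ∈ Y then f e else 0, fun e h => ?_, ?_⟩
  · by_cases he : G.s e ∈ Y
    · exact ⟨hf e (by simpa [he] using h), he⟩
    · simp [he] at h
  · ext v
    rw [G.bd_ite_mem Y f fun e he => hY e (hf e he)]
    split_ifs with hv
    · rfl
    · exact (hxY v hv).symm

lemma intCast_mem_boundaries {F : Set E} {x : V → ℤ} (hx : x ∈ G.boundaries ℤ F) :
    (fun v => (x v : A)) ∈ G.boundaries A F := by
  obtain ⟨f, hf, rfl⟩ := G.mem_boundaries.1 hx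
  refine G.mem_boundaries.2 ⟨fun e => (f e : A), fun e he => hf e fun h => he (by simp [h]), ?_⟩
  ext v
  exact G.bd_intCast f v

/-- An edge set either supports a weighting with boundary twice a vertex,
or is balanced. -/
lemma single_two_mem_boundaries_or_balanced [Fintype V] (F : Set E) :
    (∃ v, Pi.single v 2 ∈ G.boundaries ℤ F) ∨
      ∃ β : V → ℤ, (∀ v, β v = 1 ∨ β v = -1) ∧ ∀ e ∈ F, G.coef β e = 0 := by
  classical
  by_contra! hcon
  obtain ⟨hno, hbal⟩ := hcon
  -- around each vertex there is a balancing of its component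
  have hcomp : ∀ r : V, ∃ β : V → ℤ, β r = 1 ∧ (∀ v, β v = 0 ∨ β v = 1 ∨ β v = -1) ∧
      ∀ e ∈ F, G.coef β e = 0 := by
    intro r
    let R : V → ℤ → Prop := fun v κ => κ • Pi.single v 1 - Pi.single r 1 ∈ G.boundaries ℤ F
    have hne : ∀ v, R v 1 → ¬ R v (-1) := fun v h₁ h₂ => by
      refine hno r ?_
      have := Submodule.neg_mem _ (Submodule.add_mem _ h₁ h₂)
      convert this using 1
      ext v'
      simp [Pi.single_apply]
      split_ifs <;> simp
    have hadj : ∀ e ∈ F, ∀ κ : ℤ, R (G.s e) κ ↔ R (G.t e) (-(κ * G.σ e * G.τ e)) := by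
      intro e he κ
      have h := G.single_mem_boundaries (A := ℤ) he
      have hσ : (G.σ e : ℤ) * (G.σ e : ℤ) = 1 :=
        units_mul_self_cast (A := ℤ) (G.σ e)
      have hk := Submodule.smul_mem _ (κ * (G.σ e : ℤ)) h
      simp only [R]
      rw [← Submodule.sub_mem_iff_left _ hk]
      apply iff_of_eq
      congr 1
      ext v
      simp only [Pi.add_apply, Pi.sub_apply, Pi.smul_apply, smul_eq_mul, Int.cast_id]
      linear_combination -κ * (Pi.single (G.s e) (1 : ℤ) : V → ℤ) v * hσ
    refine ⟨fun v => if R v 1 then 1 else if R v (-1) then -1 else 0, ?_, fun v => ?_,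
      fun e he => ?_⟩
    · have : R r 1 := by simp [R]
      simp [this]
    · dsimp only; split_ifs <;> simp
    · have h₁ := hadj e he 1
      have h₂ := hadj e he (-1)
      have h₃ := hne (G.s e)
      have h₄ := hne (G.t e)
      simp only [coef]
      rcases Int.units_eq_one_or (G.σ e) with hs | hs <;>
        rcases Int.units_eq_one_or (G.τ e) with ht | ht <;> simp [hs, ht] at h₁ h₂ ⊢ <;>
        simp only [h₁, h₂] at h₃ ⊢ <;> split_ifs <;> simp_all
  have hpatch : ∀ S : Finset V, ∃ β : V → ℤ, (∀ v ∈ S, β v ≠ 0) ∧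
      (∀ v, β v = 0 ∨ β v = 1 ∨ β v = -1) ∧ ∀ e ∈ F, G.coef β e = 0 := by
    intro S
    induction S using Finset.induction_on with
    | empty => exact ⟨0, by simp, by simp, by simp [coef]⟩
    | insert r S hr ih =>
      obtain ⟨β, h₁, h₂, h₃⟩ := ih
      obtain ⟨γ, g₁, g₂, g₃⟩ := hcomp r
      refine ⟨fun v => if β v = 0 then γ v else β v, fun v hv => ?_, fun v => ?_, fun e he => ?_⟩
      · rcases Finset.mem_insert.1 hv with rfl | hv
        · dsimp only; split_ifs with h
          · simp [g₁]
          · exact h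
        · simp [h₁ v hv]
      · dsimp only; split_ifs
        · exact g₂ v
        · exact h₂ v
      · have a := h₃ e he
        have b := g₃ e he
        simp only [coef] at a b ⊢
        have hs : (G.σ e : ℤ) ≠ 0 := (G.σ e).ne_zero
        have ht : (G.τ e : ℤ) ≠ 0 := (G.τ e).ne_zero
        by_cases c₁ : β (G.s e) = 0 <;> by_cases c₂ : β (G.t e) = 0 <;> simp_all
  obtain ⟨β, h₁, h₂, h₃⟩ := hpatch Finset.univ
  obtain ⟨e, he, he'⟩ := hbal β fun v => (h₂ v).resolve_left (h₁ v (Finset.mem_univ v))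
  exact he' (h₃ e he)

end Boundary

end BidirectedGraph

namespace BidirectedGraph

variable {V E : Type*} [DecidableEq V] [Fintype E] (G : BidirectedGraph V E)

/-- A partial solution outside `X`: an even edge set avoiding `X` together with a `ZMod 3`-flow
relative to `X` which jointly cover all edges not inside `X`. -/
def PartialCover (X : Finset V) : Prop :=
  ∃ (B : E → ZMod 2) (ψ : E → ZMod 3), (∀ e, G.s e ∈ X ∨ G.t e ∈ X → B e = 0) ∧
    G.bd (ZMod 2) B = 0 ∧ (∀ v ∉ X, G.bd (ZMod 3) ψ v = 0) ∧
    ∀ e, ¬ (G.s e ∈ X ∧ G.t e ∈ X) → B e ≠ 0 ∨ ψ e ≠ 0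

variable {G}

lemma PartialCover.of_union {X K : Finset V} (hXK : Disjoint X K)
    (h : G.PartialCover (X ∪ K)) (C : E → ZMod 2) (hC : ∀ e, C e ≠ 0 → G.s e ∈ K ∧ G.t e ∈ K)
    (hbd : G.bd (ZMod 2) C = 0)
    (hsolve : ∀ ψ : E → ZMod 3, (∀ v ∉ X ∪ K, G.bd (ZMod 3) ψ v = 0) →
      (∀ e, G.s e ∈ X ∪ K → G.t e ∈ X ∪ K → ψ e = 0) →
      ∃ χ : E → ZMod 3, (∀ e, χ e ≠ 0 → G.s e ∈ X ∪ K ∧ G.t e ∈ X ∪ K) ∧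
        (∀ v ∈ K, G.bd (ZMod 3) ψ v + G.bd (ZMod 3) χ v = 0) ∧
        ∀ e, G.s e ∈ X ∪ K → G.t e ∈ X ∪ K → ¬ (G.s e ∈ X ∧ G.t e ∈ X) →
          C e ≠ 0 ∨ χ e ≠ 0) : G.PartialCover X := by
  obtain ⟨B, ψ, hB, hBbd, hψ, hcov⟩ := h
  let ψ' : E → ZMod 3 := fun e => if G.s e ∈ X ∪ K ∧ G.t e ∈ X ∪ K then 0 else ψ e
  have hψ' : ∀ v ∉ X ∪ K, G.bd (ZMod 3) ψ' v = 0 := by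
    intro v hv
    rw [← hψ v hv, bd_apply, bd_apply]
    refine Finset.sum_congr rfl fun e _ => ?_
    by_cases he : G.s e ∈ X ∪ K ∧ G.t e ∈ X ∪ K
    · rw [G.inc_eq_zero (e := e) (v := v) (fun h' => hv (h' ▸ he.1)) (fun h' => hv (h' ▸ he.2))]
      simp
    · simp only [ψ', if_neg he]
  obtain ⟨χ, hχ, hχK, hχC⟩ := hsolve ψ' hψ' fun e h₁ h₂ => if_pos ⟨h₁, h₂⟩
  refine ⟨B + C, ψ' + χ, fun e he => ?_, by rw [map_add, hBbd, hbd, add_zero], fun v hv => ?_,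
    fun e he => ?_⟩
  · have h₁ : C e = 0 := by
      by_contra h
      rcases he with he | he
      · exact Finset.disjoint_left.1 hXK he (hC e h).1
      · exact Finset.disjoint_left.1 hXK he (hC e h).2
    have h₂ : B e = 0 := hB e (he.imp (Finset.mem_union_left K) (Finset.mem_union_left K))
    simp [h₁, h₂]
  · rw [map_add, Pi.add_apply]
    by_cases hK : v ∈ K
    · exact hχK v hK
    · have hvXK : v ∉ X ∪ K := by simp [hv, hK]
      rw [hψ' v hvXK, zero_add, bd_apply]
      refine Finset.sum_eq_zero fun e _ => ?_
      by_cases he : χ e = 0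
      · simp [he]
      · have := hχ e he
        rw [G.inc_eq_zero (e := e) (v := v) (fun h' => hvXK (h' ▸ this.1))
          (fun h' => hvXK (h' ▸ this.2))]
        simp
  · by_cases he' : G.s e ∈ X ∪ K ∧ G.t e ∈ X ∪ K
    · have h₁ : B e = 0 := hB e (Or.inl he'.1)
      have h₂ : ψ' e = 0 := if_pos he'
      simpa [h₁, h₂] using hχC e he'.1 he'.2 he
    · have h₁ : C e = 0 := by
        by_contra h
        exact he' ⟨Finset.mem_union_right X (hC e h).1, Finset.mem_union_right X (hC e h).2⟩
      have h₂ : χ e = 0 := by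
        by_contra h
        exact he' (hχ e h)
      have h₃ : ψ' e = ψ e := if_neg he'
      simp only [Pi.add_apply, h₁, h₂, h₃, add_zero]
      exact hcov e he'

/-- Correcting an edge weighting by boundaries supported on `C`. -/
lemma exists_bd_eq_of_single_sub_mem [Fintype V] {A : Type*} [CommRing A] {C : Set E}
    {K : Finset V} (c : V → A) (x : V → A)
    (hK : ∀ v ∈ K, Pi.single v 1 - c v • x ∈ G.boundaries A C) (r : V → A)
    (hr : (∑ v ∈ K, r v * c v) • x = 0) :
    ∃ f : E → A, (∀ e, f e ≠ 0 → e ∈ C) ∧ ∀ v, G.bd A f v = if v ∈ K then r v else 0 := by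
  have h := Submodule.sum_mem _ fun v hv => Submodule.smul_mem _ (r v) (hK v hv)
  obtain ⟨f, hf, hf'⟩ := G.mem_boundaries.1 h
  refine ⟨f, hf, fun v => ?_⟩
  rw [hf']
  simp only [smul_sub, Finset.sum_sub_distrib, smul_smul, ← Finset.sum_smul, hr, sub_zero]
  simp [Finset.sum_apply, Pi.single_apply]

/-- The edges with both ends outside `X`. -/
def outside (G : BidirectedGraph V E) (X : Finset V) : Set E := {e | G.s e ∉ X ∧ G.t e ∉ X}

lemma eq_zero_of_mem_boundaries {A : Type*} [CommRing A] {X : Finset V} {F : Set E}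
    (hF : F ⊆ G.outside X) {x : V → A} (hx : x ∈ G.boundaries A F) {v : V} (hv : v ∈ X) :
    x v = 0 := by
  obtain ⟨f, hf, rfl⟩ := G.mem_boundaries.1 hx
  rw [bd_apply]
  refine Finset.sum_eq_zero fun e _ => ?_
  by_cases he : f e = 0
  · simp [he]
  · have := hF (hf e he)
    rw [G.inc_eq_zero (e := e) (v := v) (fun h => this.1 (h.symm ▸ hv))
      (fun h => this.2 (h.symm ▸ hv))]
    simp

lemma PartialCover.of_single_two_mem [Fintype V] {X : Finset V}
    (ih : ∀ Y, X ⊂ Y → G.PartialCover Y) {r : V}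
    (hr : Pi.single r 2 ∈ G.boundaries ℤ (G.outside X)) : G.PartialCover X := by
  classical
  obtain ⟨f, hf, hbd⟩ := G.mem_boundaries.1 hr
  let C : E → ZMod 2 := fun e => (f e : ZMod 2)
  have hCF : ∀ e, C e ≠ 0 → e ∈ G.outside X := fun e he => hf e fun h => he (by simp [C, h])
  have hCbd : G.bd (ZMod 2) C = 0 := by
    ext v
    rw [bd_intCast, hbd, Pi.zero_apply, ZMod.intCast_zmod_eq_zero_iff_dvd, Pi.single_apply]
    split_ifs <;> simp
  let S : Set E := {e | C e ≠ 0}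
  obtain ⟨w, hw⟩ : ∃ v, Pi.single v 2 ∈ G.boundaries ℤ S := by
    refine (G.single_two_mem_boundaries_or_balanced S).resolve_right ?_
    rintro ⟨β, hβ, hβS⟩
    have h₁ := G.sum_mul_bd β f
    rw [hbd] at h₁
    have h₂ : (4 : ℤ) ∣ ∑ e, f e * G.coef β e := by
      refine Finset.dvd_sum fun e _ => ?_
      by_cases he : C e = 0
      · have h₃ : (2 : ℤ) ∣ f e := (ZMod.intCast_zmod_eq_zero_iff_dvd _ _).1 he
        have h₄ : (2 : ℤ) ∣ G.coef β e := by
          simp only [coef]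
          rcases Int.units_eq_one_or (G.σ e) with a | a <;>
            rcases Int.units_eq_one_or (G.τ e) with b | b <;>
            rcases hβ (G.s e) with c | c <;> rcases hβ (G.t e) with d | d <;>
            simp [a, b, c, d]
        exact mul_dvd_mul h₃ h₄
      · simp [hβS e he]
    rw [← h₁] at h₂
    simp [Pi.single_apply] at h₂
    rcases hβ r with h | h <;> rw [h] at h₂ <;> omega
  let K : Finset V := Finset.univ.filter fun v =>
    v ∉ X ∧ Pi.single v (1 : ZMod 3) ∈ G.boundaries (ZMod 3) S
  have hKmem : ∀ v, v ∈ K ↔ v ∉ X ∧ Pi.single v (1 : ZMod 3) ∈ G.boundaries (ZMod 3) S := by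
    simp [K]
  have hclosed : ∀ e ∈ S, (G.s e ∈ K ↔ G.t e ∈ K) := by
    intro e he
    have h₁ := hCF e he
    have h₂ := G.single_sub_smul_mem_boundaries_iff he (0 : V → ZMod 3) 0 (by simp [coef])
    simp only [smul_zero, sub_zero] at h₂
    rw [hKmem, hKmem, h₂]
    simp [h₁.1, h₁.2]
  have hw' : Pi.single w (1 : ZMod 3) ∈ G.boundaries (ZMod 3) S := by
    have := Submodule.smul_mem _ (2 : ZMod 3) (G.intCast_mem_boundaries (A := ZMod 3) hw)
    convert this using 1
    ext v
    simp only [Pi.single_apply, Pi.smul_apply]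
    split_ifs
    · exact (by decide : (1 : ZMod 3) = 2 * ((2 : ℤ) : ZMod 3))
    · simp
  have hwK : w ∈ K := (hKmem w).2 ⟨fun h => by
    simpa using eq_zero_of_mem_boundaries (fun e he => hCF e he) hw' h, hw'⟩
  have hXK : Disjoint X K := Finset.disjoint_right.2 fun v hv => ((hKmem v).1 hv).1
  refine (ih (X ∪ K) (Finset.ssubset_iff_subset_ne.2 ⟨Finset.subset_union_left, fun h => ?_⟩)
    ).of_union hXK (fun e => if G.s e ∈ K then C e else 0) (fun e he => ?_) ?_ ?_
  · exact ((hKmem w).1 hwK).1 (h ▸ Finset.mem_union_right X hwK)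
  · by_cases h : G.s e ∈ K
    · exact ⟨h, (hclosed e (show C e ≠ 0 by simpa [h] using he)).1 h⟩
    · simp [h] at he
  · ext v
    rw [G.bd_ite_mem K C hclosed, hCbd]
    simp
  · intro ψ hψ hψ0
    let ψ₀ : E → ZMod 3 := fun e => if G.s e ∈ X ∪ K ∧ G.t e ∈ X ∪ K then 1 else 0
    obtain ⟨g, hg, hgbd⟩ := exists_bd_eq_of_single_sub_mem (G := G)
      (C := {e | e ∈ S ∧ G.s e ∈ K}) (K := K) (0 : V → ZMod 3) 0 (fun v hv => by
        rw [smul_zero, sub_zero]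
        refine G.mem_boundaries_restrict hclosed ((hKmem v).1 hv).2 fun v' hv' => ?_
        exact Pi.single_eq_of_ne (fun h => hv' (by rwa [h])) _)
      (fun v => -(G.bd (ZMod 3) ψ v + G.bd (ZMod 3) ψ₀ v)) (by simp)
    refine ⟨ψ₀ + g, fun e he => ?_, fun v hv => ?_, fun e h₁ h₂ _ => ?_⟩
    · by_cases h : g e = 0
      · by_contra h'
        simp [ψ₀, h, -Finset.mem_union, h'] at he
      · obtain ⟨h₁, h₂⟩ := hg e h
        exact ⟨Finset.mem_union_right X h₂, Finset.mem_union_right X ((hclosed e h₁).1 h₂)⟩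
    · rw [map_add, Pi.add_apply, hgbd, if_pos hv]
      ring
    · by_cases h : g e = 0
      · right
        simp [ψ₀, h, -Finset.mem_union, h₁, h₂]
      · left
        obtain ⟨h₁, h₂⟩ := hg e h
        simpa [show G.s e ∈ K from h₂] using show C e ≠ 0 from h₁

/-- No `{-1, 0, 1}`-valued vertex weighting has coboundary of total size one or two. -/
def NoSmallCut [Fintype V] (G : BidirectedGraph V E) : Prop :=
  ∀ β : V → ℤ, (∀ v, |β v| ≤ 1) → ∑ e, |G.coef β e| ≠ 1 ∧ ∑ e, |G.coef β e| ≠ 2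

open Classical in
lemma sum_abs_coef_ite {X L : Finset V} (hLX : Disjoint L X) {β : V → ℤ}
    (hβ : ∀ v, β v = 1 ∨ β v = -1) (hbal : ∀ e ∈ G.outside X, G.coef β e = 0) :
    ∑ e, |G.coef (fun v => if v ∈ L then β v else 0) e| = #{e | G.Crosses L e} := by
  rw [Finset.card_filter]
  push_cast
  refine Finset.sum_congr rfl fun e _ => ?_
  split_ifs with h
  · rcases coef_ite_of_crosses h hβ with h' | h' <;> simp [h']
  · rw [coef_ite_of_not_crosses h fun hs => hbal e ⟨Finset.disjoint_left.1 hLX hs,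
      Finset.disjoint_left.1 hLX (by rw [Crosses, not_not] at h; exact h.1 hs)⟩, abs_zero]

lemma PartialCover.of_not_crosses [Fintype V] {X L : Finset V}
    (ih : ∀ Y, X ⊂ Y → G.PartialCover Y) (hLX : Disjoint L X) (hL : L.Nonempty) {β : V → ℤ}
    (hβ : ∀ v, β v = 1 ∨ β v = -1) (hbal : ∀ e ∈ G.outside X, G.coef β e = 0)
    (hcross : ∀ e, ¬ G.Crosses L e) : G.PartialCover X := by
  classical
  obtain ⟨r, hr⟩ := hL
  have hrX := Finset.disjoint_left.1 hLX hr
  have hβ' : ∀ v, (β v : ZMod 3) = 1 ∨ (β v : ZMod 3) = -1 := fun v => intCast_eq_one_or (hβ v)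
  refine (ih (X ∪ {r}) (Finset.ssubset_iff_subset_ne.2 ⟨Finset.subset_union_left, fun h => ?_⟩)
    ).of_union (Finset.disjoint_singleton_right.2 hrX) 0 (by simp) (by simp) ?_
  · exact hrX (h ▸ Finset.mem_union_right X (Finset.mem_singleton_self r))
  · intro ψ hψ hψ0
    let χ : E → ZMod 3 := fun e => if G.s e ∈ X ∪ {r} ∧ G.t e ∈ X ∪ {r} then 1 else 0
    refine ⟨χ, fun e he => ?_, fun v hv => ?_, fun e h₁ h₂ _ => Or.inr ?_⟩
    · by_contra h'
      exact he (if_neg h')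
    · obtain rfl := Finset.mem_singleton.1 hv
      have h₁ := G.sum_mul_bd (fun v => if v ∈ L then (β v : ZMod 3) else 0) (ψ + χ)
      have h₂ : ∀ e, G.coef (fun v => if v ∈ L then (β v : ZMod 3) else 0) e = 0 := fun e =>
        coef_ite_of_not_crosses (hcross e) fun hs => by
          have := hcross e
          rw [Crosses, not_not] at this
          rw [coef_intCast, hbal e ⟨Finset.disjoint_left.1 hLX hs,
            Finset.disjoint_left.1 hLX (this.1 hs)⟩, Int.cast_zero]
      simp only [h₂, mul_zero, Finset.sum_const_zero] at h₁
      rw [Finset.sum_eq_single v] at h₁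
      · simp only [if_pos hr, map_add, Pi.add_apply] at h₁
        rcases hβ' v with h | h <;> rw [h] at h₁
        · rwa [one_mul] at h₁
        · rwa [neg_one_mul, neg_eq_zero] at h₁
      · intro v' _ hne
        by_cases hv' : v' ∈ L
        · have hv'X : v' ∉ X ∪ {v} := by
            simp [Finset.disjoint_left.1 hLX hv', hne]
          have hχ : G.bd (ZMod 3) χ v' = 0 := by
            rw [bd_apply]
            refine Finset.sum_eq_zero fun e _ => ?_
            by_cases he : G.s e ∈ X ∪ {v} ∧ G.t e ∈ X ∪ {v}
            · rw [G.inc_eq_zero (e := e) (v := v') (fun h => hv'X (h ▸ he.1))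
                (fun h => hv'X (h ▸ he.2))]
              simp
            · rw [show χ e = 0 from if_neg he, zero_mul]
          rw [map_add, Pi.add_apply, hψ v' hv'X, hχ]
          simp
        · simp [hv']
      · simp
    · rw [show χ e = 1 from if_pos ⟨h₁, h₂⟩]
      exact one_ne_zero

end BidirectedGraph

namespace BidirectedGraph

variable {V E : Type*} [DecidableEq V] {G : BidirectedGraph V E}

lemma exists_end_of_crosses {X L : Finset V} {e : E} (hLX : Disjoint L X) (h : G.Crosses L e)
    (he : e ∉ G.outside X) :
    ∃ u ∈ L, ∀ K, u ∈ K → Disjoint X K →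
      G.Crosses K e ∧ G.s e ∈ X ∪ K ∧ G.t e ∈ X ∪ K := by
  have hL := fun v (hv : v ∈ L) => Finset.disjoint_left.1 hLX hv
  simp only [outside, Set.mem_ofPred_eq, not_and_or, not_not] at he
  simp only [Crosses] at h ⊢
  by_cases hs : G.s e ∈ L
  · have ht : G.t e ∈ X := he.resolve_left (hL _ hs)
    refine ⟨_, hs, fun K hK hXK => ?_⟩
    have := Finset.disjoint_left.1 hXK ht
    simp [hK, ht, this]
  · have ht : G.t e ∈ L := by tauto
    have hsX : G.s e ∈ X := he.resolve_right (hL _ ht)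
    refine ⟨_, ht, fun K hK hXK => ?_⟩
    have := Finset.disjoint_left.1 hXK hsX
    simp [hK, hsX, this]

lemma inc_cast_zmod_two (e : E) (v : V) :
    ((G.inc e v : ℤ) : ZMod 2) =
      (((if G.t e = v then 1 else 0) - (if G.s e = v then 1 else 0) : ℤ) : ZMod 2) := by
  simp only [inc]
  rcases Int.units_eq_one_or (G.σ e) with a | a <;>
    rcases Int.units_eq_one_or (G.τ e) with b | b <;> rw [a, b] <;> split_ifs <;> decide

variable [Fintype E]

lemma bd_intCast_zmod_two (x : E → ℤ) (v : V) :
    G.bd (ZMod 2) (fun e => (x e : ZMod 2)) v = (netInflow G.s G.t x v : ZMod 2) := by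
  simp only [bd_apply, netInflow, Int.cast_sum, Int.cast_mul, inc_cast_zmod_two]

open Classical in
/-- Two units of flow between any two vertices of `L`, if every proper part of `L` is joined
to the rest of `L` by at least two edges. -/
lemma exists_netInflow_two [Fintype V] {L : Finset V}
    (hL : ∀ A ⊂ L, A.Nonempty → 2 ≤ #{e | G.Crosses A e ∧ G.s e ∈ L ∧ G.t e ∈ L})
    {u w : V} (hu : u ∈ L) (hw : w ∈ L) :
    ∃ x : E → ℤ, (∀ e, -1 ≤ x e ∧ x e ≤ 1) ∧ (∀ e, x e ≠ 0 → G.s e ∈ L ∧ G.t e ∈ L) ∧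
      ∀ v, netInflow G.s G.t x v = 2 * ((if w = v then 1 else 0) - if u = v then 1 else 0) := by
  let c : E → ℤ := fun e => if G.s e ∈ L ∧ G.t e ∈ L then 1 else 0
  have hc : ∀ e, 0 ≤ c e ∧ c e ≤ 1 := fun e => by dsimp only [c]; split_ifs <;> simp
  obtain ⟨x, hx, hx'⟩ := exists_netInflow_eq G.s G.t
    (fun v => 2 * ((if w = v then 1 else 0) - if u = v then 1 else 0))
    (by rw [← Finset.mul_sum]; simp) (fun e => -c e) c (fun e => by have := hc e; linarith)
    (fun S => by
      have hcap : cutCapacity G.s G.t (fun e => -c e) c S =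
          #{e | G.Crosses (S ∩ L) e ∧ G.s e ∈ L ∧ G.t e ∈ L} := by
        rw [cutCapacity, Finset.card_filter]
        push_cast
        refine Finset.sum_congr rfl fun e _ => ?_
        by_cases h₁ : G.s e ∈ L <;> by_cases h₂ : G.t e ∈ L <;> by_cases h₃ : G.s e ∈ S <;>
          by_cases h₄ : G.t e ∈ S <;> simp [Crosses, c, h₁, h₂, h₃, h₄]
      rw [hcap, ← Finset.mul_sum, Finset.sum_sub_distrib]
      simp only [Finset.sum_ite_eq]
      by_cases h₁ : w ∈ S
      · by_cases h₂ : u ∈ S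
        · simp [h₁, h₂]
        · have := hL (S ∩ L) (Finset.ssubset_iff_subset_ne.2 ⟨Finset.inter_subset_right,
            fun h => h₂ (Finset.mem_inter.1 (h.symm ▸ hu)).1⟩) ⟨w, Finset.mem_inter.2 ⟨h₁, hw⟩⟩
          simp only [if_pos h₁, if_neg h₂]
          omega
      · split_ifs <;> simp)
  refine ⟨x, fun e => ?_, fun e he => ?_, hx'⟩
  · have := hx e; have := hc e; constructor <;> linarith
  · by_contra h
    have := hx e
    simp only [c, if_neg h] at this
    omega

lemma exists_ne_zero_combination (a b c : ZMod 3) (hb : b ≠ 0) (hc : c ≠ 0) :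
    ∃ x y : ZMod 3, x ≠ 0 ∧ y ≠ 0 ∧ a + x * b + y * c = 0 := by
  revert a b c; decide

lemma PartialCover.of_netInflow_two [Fintype V] {X L : Finset V}
    (ih : ∀ Y, X ⊂ Y → G.PartialCover Y) (hLX : Disjoint L X) {β : V → ℤ}
    (hβ : ∀ v, β v = 1 ∨ β v = -1) (hbal : ∀ e ∈ G.outside X, G.coef β e = 0)
    {u w : V} (hu : u ∈ L) {e₁ e₂ : E} (hne : e₁ ≠ e₂)
    (h₁ : ∀ K, u ∈ K → Disjoint X K → G.Crosses K e₁ ∧ G.s e₁ ∈ X ∪ K ∧ G.t e₁ ∈ X ∪ K)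
    (h₂ : ∀ K, w ∈ K → Disjoint X K → G.Crosses K e₂ ∧ G.s e₂ ∈ X ∪ K ∧ G.t e₂ ∈ X ∪ K)
    {x : E → ℤ} (hx : ∀ e, -1 ≤ x e ∧ x e ≤ 1) (hxL : ∀ e, x e ≠ 0 → G.s e ∈ L ∧ G.t e ∈ L)
    (hxbd : ∀ v, netInflow G.s G.t x v =
      2 * ((if w = v then 1 else 0) - if u = v then 1 else 0)) : G.PartialCover X := by
  classical
  have hL := fun v (hv : v ∈ L) => Finset.disjoint_left.1 hLX hv
  let C : E → ZMod 2 := fun e => (x e : ZMod 2)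
  have hCx : ∀ e, x e ≠ 0 → C e ≠ 0 := fun e he h => by
    have := hx e
    have h' := (ZMod.intCast_zmod_eq_zero_iff_dvd (x e) 2).1 h
    push_cast at h'
    omega
  have hCL : ∀ e, C e ≠ 0 → G.s e ∈ L ∧ G.t e ∈ L := fun e he => hxL e fun h => he (by simp [C, h])
  have hCbd : G.bd (ZMod 2) C = 0 := by
    ext v
    rw [bd_intCast_zmod_two, hxbd, Pi.zero_apply, ZMod.intCast_zmod_eq_zero_iff_dvd]
    exact dvd_mul_right _ _
  let S : Set E := {e | C e ≠ 0}
  have hSbal : ∀ e ∈ S, G.coef (fun v => (β v : ZMod 3)) e = 0 := fun e he => by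
    rw [coef_intCast, hbal e ⟨hL _ (hCL e he).1, hL _ (hCL e he).2⟩, Int.cast_zero]
  have hβ' : ∀ v, (β v : ZMod 3) = 1 ∨ (β v : ZMod 3) = -1 := fun v => intCast_eq_one_or (hβ v)
  have hβsq : (β u : ZMod 3) * (β u : ZMod 3) = 1 := by rcases hβ' u with h | h <;> simp [h]
  let x₀ : V → ZMod 3 := (β u : ZMod 3) • Pi.single u 1
  let K : Finset V := Finset.univ.filter fun v =>
    v ∉ X ∧ Pi.single v (1 : ZMod 3) - (β v : ZMod 3) • x₀ ∈ G.boundaries (ZMod 3) S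
  have hKmem : ∀ v, v ∈ K ↔ v ∉ X ∧
      Pi.single v (1 : ZMod 3) - (β v : ZMod 3) • x₀ ∈ G.boundaries (ZMod 3) S := by
    simp [K]
  have hXK : Disjoint X K := Finset.disjoint_right.2 fun v hv => ((hKmem v).1 hv).1
  have hclosed : ∀ e ∈ S, (G.s e ∈ K ↔ G.t e ∈ K) := by
    intro e he
    rw [hKmem, hKmem, G.single_sub_smul_mem_boundaries_iff he (fun v => (β v : ZMod 3)) x₀
      (hSbal e he)]
    simp [hL _ (hCL e he).1, hL _ (hCL e he).2]
  have huK : u ∈ K := (hKmem u).2 ⟨hL u hu, by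
    simp only [x₀, smul_smul, hβsq, one_smul, sub_self, Submodule.zero_mem]⟩
  have hwK : w ∈ K := by
    by_contra hwK
    have h := sum_netInflow G.s G.t x K
    rw [Finset.sum_congr rfl fun v _ => hxbd v, ← Finset.mul_sum, Finset.sum_sub_distrib,
      Finset.sum_eq_zero (s := Finset.univ)] at h
    · simp [huK, hwK] at h
    · intro e _
      by_cases he : x e = 0
      · simp [he]
      · simp [hclosed e (hCx e he)]
  obtain ⟨h₁c, h₁s, h₁t⟩ := h₁ K huK hXK
  obtain ⟨h₂c, h₂s, h₂t⟩ := h₂ K hwK hXK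
  refine (ih (X ∪ K) (Finset.ssubset_iff_subset_ne.2 ⟨Finset.subset_union_left, fun h => ?_⟩)
    ).of_union hXK (fun e => if G.s e ∈ K then C e else 0) (fun e he => ?_) ?_ ?_
  · exact ((hKmem u).1 huK).1 (h ▸ Finset.mem_union_right X huK)
  · by_cases h : G.s e ∈ K
    · exact ⟨h, (hclosed e (show C e ≠ 0 by simpa [h] using he)).1 h⟩
    · simp [h] at he
  · ext v
    rw [G.bd_ite_mem K C hclosed, hCbd]
    simp
  · intro ψ hψ hψ0
    let ψ₀ : E → ZMod 3 := fun e =>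
      if e = e₁ ∨ e = e₂ then 0 else if G.s e ∈ X ∪ K ∧ G.t e ∈ X ∪ K then 1 else 0
    let βK : V → ZMod 3 := fun v => if v ∈ K then (β v : ZMod 3) else 0
    obtain ⟨y₁, y₂, hy₁, hy₂, hy⟩ := exists_ne_zero_combination
      (∑ e, (ψ + ψ₀) e * G.coef βK e) (G.coef βK e₁) (G.coef βK e₂)
      (by rcases coef_ite_of_crosses h₁c hβ' with h | h <;> rw [h] <;> decide)
      (by rcases coef_ite_of_crosses h₂c hβ' with h | h <;> rw [h] <;> decide)
    let χ : E → ZMod 3 := ψ₀ + Pi.single e₁ y₁ + Pi.single e₂ y₂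
    have hχ₁ : χ e₁ = y₁ := by simp [χ, ψ₀, hne]
    have hχ₂ : χ e₂ = y₂ := by simp [χ, ψ₀, hne.symm]
    have hχ : ∀ e, e ≠ e₁ → e ≠ e₂ →
        χ e = if G.s e ∈ X ∪ K ∧ G.t e ∈ X ∪ K then 1 else 0 := fun e a b => by
      simp [χ, ψ₀, a, b]
    have hχK : ∀ e, χ e ≠ 0 ↔ G.s e ∈ X ∪ K ∧ G.t e ∈ X ∪ K := by
      intro e
      by_cases a : e = e₁
      · subst a; simp [hχ₁, hy₁, h₁s, h₁t, -Finset.mem_union]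
      by_cases b : e = e₂
      · subst b; simp [hχ₂, hy₂, h₂s, h₂t, -Finset.mem_union]
      rw [hχ e a b]
      split_ifs with h <;> simp [h, -Finset.mem_union]
    have hsum : ∑ v ∈ K, (G.bd (ZMod 3) ψ v + G.bd (ZMod 3) χ v) * (β v : ZMod 3) = 0 := by
      have h := G.sum_mul_bd βK (ψ + χ)
      have h' : ∑ e, (ψ + χ) e * G.coef βK e = 0 := by
        rw [← hy]
        simp only [χ, ← add_assoc, Pi.add_apply, add_mul, Finset.sum_add_distrib]
        simp [Pi.single_apply]
      rw [h'] at h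
      rw [← h]
      simp [βK, Finset.sum_ite_mem, mul_comm]
    obtain ⟨g, hg, hgbd⟩ := exists_bd_eq_of_single_sub_mem (G := G)
      (C := {e | e ∈ S ∧ G.s e ∈ K}) (K := K) (fun v => (β v : ZMod 3)) x₀ (fun v hv => by
        refine G.mem_boundaries_restrict hclosed ((hKmem v).1 hv).2 fun v' hv' => ?_
        have a : v' ≠ v := fun h => hv' (by rwa [h])
        have b : v' ≠ u := fun h => hv' (by rwa [h])
        simp [x₀, a, b])
      (fun v => -(G.bd (ZMod 3) ψ v + G.bd (ZMod 3) χ v)) (by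
        simp only [neg_mul, Finset.sum_neg_distrib, hsum, neg_zero, zero_smul])
    refine ⟨χ + g, fun e he => ?_, fun v hv => ?_, fun e h₁ h₂ _ => ?_⟩
    · by_cases h : g e = 0
      · exact (hχK e).1 (by simpa [h] using he)
      · obtain ⟨h₁, h₂⟩ := hg e h
        exact ⟨Finset.mem_union_right X h₂, Finset.mem_union_right X ((hclosed e h₁).1 h₂)⟩
    · rw [map_add, Pi.add_apply, hgbd, if_pos hv]
      ring
    · by_cases h : g e = 0
      · right
        simpa [h] using (hχK e).2 ⟨h₁, h₂⟩
      · left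
        obtain ⟨h₁, h₂⟩ := hg e h
        simpa [show G.s e ∈ K from h₂] using show C e ≠ 0 from h₁

open Classical in
lemma card_crosses_add_card_crosses_sdiff_le {X L A : Finset V} (hA : A ⊆ L) :
    #{e | G.Crosses A e ∧ e ∈ G.outside X} + #{e | G.Crosses (L \ A) e ∧ e ∈ G.outside X} ≤
      #{e | G.Crosses L e ∧ e ∈ G.outside X} +
        2 * #{e | G.Crosses A e ∧ G.s e ∈ L ∧ G.t e ∈ L} := by
  simp only [Finset.card_filter, Finset.mul_sum, ← Finset.sum_add_distrib]
  refine Finset.sum_le_sum fun e _ => ?_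
  simp only [Crosses, Finset.mem_sdiff]
  by_cases hs : G.s e ∈ L <;> by_cases ht : G.t e ∈ L <;> by_cases hs' : G.s e ∈ A <;>
    by_cases ht' : G.t e ∈ A <;> by_cases ho : e ∈ G.outside X <;>
    first
    | exact absurd (hA hs') hs
    | exact absurd (hA ht') ht
    | simp only [hs, ht, hs', ht', ho]; simp

lemma PartialCover.of_balanced [Fintype V] (hG : G.NoSmallCut) {X : Finset V}
    (ih : ∀ Y, X ⊂ Y → G.PartialCover Y) (hX : X ≠ Finset.univ) {β : V → ℤ}
    (hβ : ∀ v, β v = 1 ∨ β v = -1) (hbal : ∀ e ∈ G.outside X, G.coef β e = 0) :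
    G.PartialCover X := by
  classical
  let d : Finset V → ℕ := fun L => #{e | G.Crosses L e ∧ e ∈ G.outside X}
  obtain ⟨L, hL, hmin⟩ := Finset.exists_min_image
    (Finset.univ.filter fun L : Finset V => L.Nonempty ∧ Disjoint L X ∧ d L ≤ 1) Finset.card
    ⟨Xᶜ, by
      have : d Xᶜ = 0 := by
        simp only [d, Finset.card_eq_zero, Finset.filter_eq_empty_iff]
        rintro e - ⟨h₁, h₂⟩
        exact h₁ (by simp [h₂.1, h₂.2])
      simp only [Finset.mem_filter, Finset.mem_univ, true_and, this, zero_le, and_true]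
      exact ⟨by rwa [Finset.nonempty_iff_ne_empty, Ne, Finset.compl_eq_empty_iff],
        disjoint_compl_left⟩⟩
  simp only [Finset.mem_filter, Finset.mem_univ, true_and] at hL hmin
  obtain ⟨hLne, hLX, hLd⟩ := hL
  have hmin' : ∀ A ⊂ L, A.Nonempty → 2 ≤ d A := fun A hA hne => by
    by_contra h
    have := hmin A ⟨hne, hLX.mono_left hA.subset, by omega⟩
    have := Finset.card_lt_card hA
    omega
  by_cases hcross : ∀ e, ¬ G.Crosses L e
  · exact PartialCover.of_not_crosses ih hLX hLne hβ hbal hcross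
  have hcut := hG (fun v => if v ∈ L then β v else 0) fun v => by
    split_ifs
    · rcases hβ v with h | h <;> simp [h]
    · simp
  rw [sum_abs_coef_ite hLX hβ hbal] at hcut
  have hpos : 0 < #{e | G.Crosses L e} := by
    push Not at hcross
    obtain ⟨e, he⟩ := hcross
    exact Finset.card_pos.2 ⟨e, by simpa using he⟩
  have hsplit := Finset.card_filter_add_card_filter_not
    (s := Finset.univ.filter fun e => G.Crosses L e) (fun e => e ∈ G.outside X)
  rw [Finset.filter_filter, Finset.filter_filter] at hsplit
  have htwo : 1 < #{e | G.Crosses L e ∧ e ∉ G.outside X} := by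
    have : #{e | G.Crosses L e ∧ e ∈ G.outside X} ≤ 1 := hLd
    omega
  obtain ⟨e₁, he₁, e₂, he₂, hne⟩ := Finset.one_lt_card.1 htwo
  simp only [Finset.mem_filter, Finset.mem_univ, true_and] at he₁ he₂
  obtain ⟨u, hu, h₁⟩ := exists_end_of_crosses hLX he₁.1 he₁.2
  obtain ⟨w, hw, h₂⟩ := exists_end_of_crosses hLX he₂.1 he₂.2
  obtain ⟨x, hx, hxL, hxbd⟩ := exists_netInflow_two (G := G) (fun A hA hne => by
    have a₁ := hmin' A hA hne
    have a₂ := hmin' (L \ A) (Finset.ssubset_iff_subset_ne.2 ⟨Finset.sdiff_subset, fun h => by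
      obtain ⟨v, hv⟩ := hne
      exact (Finset.mem_sdiff.1 (h.symm ▸ hA.subset hv)).2 hv⟩)
      (Finset.sdiff_nonempty.2 hA.2)
    have key := card_crosses_add_card_crosses_sdiff_le (G := G) (X := X) hA.subset
    simp only [d] at a₁ a₂ hLd
    omega) hu hw
  exact PartialCover.of_netInflow_two ih hLX hβ hbal hu hne h₁ h₂ hx hxL hxbd

lemma NoSmallCut.partialCover [Fintype V] (hG : G.NoSmallCut) (X : Finset V) :
    G.PartialCover X := by
  classical
  induction hn : #Xᶜ using Nat.strong_induction_on generalizing X with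
  | _ n ih =>
  have ih' : ∀ Y, X ⊂ Y → G.PartialCover Y := fun Y hY =>
    ih _ (hn ▸ Finset.card_lt_card (Finset.compl_ssubset_compl.2 hY)) Y rfl
  by_cases hX : X = Finset.univ
  · subst hX
    exact ⟨0, 0, by simp, by simp, by simp, by simp⟩
  · rcases G.single_two_mem_boundaries_or_balanced (G.outside X) with ⟨v, hv⟩ | ⟨β, hβ, hbal⟩
    · exact PartialCover.of_single_two_mem ih' hv
    · exact PartialCover.of_balanced hG ih' hX hβ hbal

/-- A bidirected graph without small cuts is covered by an even edge set and a `ZMod 3`-flow. -/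
lemma NoSmallCut.exists_cover [Fintype V] (hG : G.NoSmallCut) :
    ∃ (B : E → ZMod 2) (ψ : E → ZMod 3), G.bd (ZMod 2) B = 0 ∧ G.bd (ZMod 3) ψ = 0 ∧
      ∀ e, B e ≠ 0 ∨ ψ e ≠ 0 := by
  obtain ⟨B, ψ, -, hB, hψ, h⟩ := hG.partialCover ∅
  exact ⟨B, ψ, hB, funext fun v => hψ v (by simp), fun e => h e (by simp)⟩

end BidirectedGraph

namespace BidirectedGraph

variable {V E : Type*} (G : BidirectedGraph V E)

/-- Tails of the arcs of the double cover: `(e, true)` runs from `(s e, -σ e)` to `(t e, τ e)`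
and `(e, false)` from `(t e, -τ e)` to `(s e, σ e)`. -/
def coverSrc (a : E × Bool) : V × ℤˣ :=
  if a.2 then (G.s a.1, -G.σ a.1) else (G.t a.1, -G.τ a.1)

/-- Heads of the arcs of the double cover. -/
def coverTgt (a : E × Bool) : V × ℤˣ :=
  if a.2 then (G.t a.1, G.τ a.1) else (G.s a.1, G.σ a.1)

variable [DecidableEq V]

lemma coef_coverCut (S : Finset (V × ℤˣ)) (e : E) :
    G.coef (fun v => ((if (v, 1) ∈ S then 1 else 0) - (if (v, -1) ∈ S then 1 else 0) : ℤ)) e =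
      ∑ i, ((if G.coverTgt (e, i) ∈ S then 1 else 0) -
        (if G.coverSrc (e, i) ∈ S then 1 else 0)) := by
  rw [Fintype.sum_bool]
  rcases Int.units_eq_one_or (G.σ e) with a | a <;>
    rcases Int.units_eq_one_or (G.τ e) with b | b <;>
    simp [coef, coverSrc, coverTgt, a, b] <;> ring

lemma sum_sign_mul [Fintype V] (S : Finset (V × ℤˣ)) (r : V → ℤ) :
    ∑ w ∈ S, (w.2 : ℤ) * r w.1 =
      ∑ v, r v * ((if (v, 1) ∈ S then 1 else 0) - (if (v, -1) ∈ S then 1 else 0)) := by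
  rw [← Finset.univ_inter S, ← Finset.sum_ite_mem, Fintype.sum_prod_type]
  refine Finset.sum_congr rfl fun v _ => ?_
  have h : (Finset.univ : Finset ℤˣ) = {1, -1} := by decide
  rw [h, Finset.sum_pair (by decide)]
  split_ifs <;> simp_all

/-- In a connected bidirected graph, the edges that are not positive loops are in one component. -/
def EdgeConnected (G : BidirectedGraph V E) : Prop :=
  ∀ Y : Finset V, (∀ e, G.s e ∈ Y ↔ G.t e ∈ Y) →
    (∀ e, ¬ G.Trivial e → G.s e ∈ Y) ∨ ∀ e, ¬ G.Trivial e → G.s e ∉ Y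

variable [Fintype E]

lemma netInflow_cover_sub (y : E × Bool → ℤ) (v : V) :
    netInflow G.coverSrc G.coverTgt y (v, 1) - netInflow G.coverSrc G.coverTgt y (v, -1) =
      G.bd ℤ (fun e => y (e, false) + y (e, true)) v := by
  rw [netInflow, netInflow, ← Finset.sum_sub_distrib, Fintype.sum_prod_type, bd_apply]
  refine Finset.sum_congr rfl fun e _ => ?_
  rcases Int.units_eq_one_or (G.σ e) with a | a <;>
    rcases Int.units_eq_one_or (G.τ e) with b | b <;>
    by_cases c : G.s e = v <;> by_cases d : G.t e = v <;>
    simp [inc, coverSrc, coverTgt, a, b, c, d] <;> ring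

lemma netInflow_cover_fst (ψ : E → ℤ) (v : V) (κ : ℤˣ) :
    netInflow G.coverSrc G.coverTgt (fun a => ψ a.1) (v, κ) = κ * G.bd ℤ ψ v := by
  rw [netInflow, Fintype.sum_prod_type, bd_apply, Finset.mul_sum]
  refine Finset.sum_congr rfl fun e _ => ?_
  rcases Int.units_eq_one_or (G.σ e) with a | a <;>
    rcases Int.units_eq_one_or (G.τ e) with b | b <;>
    rcases Int.units_eq_one_or κ with k | k <;>
    by_cases c : G.s e = v <;> by_cases d : G.t e = v <;>
    simp [inc, coverSrc, coverTgt, a, b, c, d, k] <;> ring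

variable {G}

/-- Any demand supported on the edges of a connected bidirected graph is a boundary modulo two,
up to a correction at one vertex. -/
lemma EdgeConnected.exists_bd_zmod_two [Fintype V] (hG : G.EdgeConnected) (T : V → ZMod 2)
    (hT : ∀ v, T v ≠ 0 → ∃ e, ¬ G.Trivial e ∧ (G.s e = v ∨ G.t e = v)) :
    ∃ (m : E → ZMod 2) (r : V → ℤ), (r = 0 ∨ ∃ v, r = Pi.single v 1) ∧
      ∀ v, G.bd (ZMod 2) m v = T v + r v := by
  classical
  by_cases hT0 : ∀ v, T v = 0
  · exact ⟨0, 0, Or.inl rfl, fun v => by simp [hT0 v]⟩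
  push Not at hT0
  obtain ⟨r, hr⟩ := hT0
  let x₀ : V → ZMod 2 := Pi.single r 1
  let K : Finset V := Finset.univ.filter fun v =>
    Pi.single v (1 : ZMod 2) - (1 : V → ZMod 2) v • x₀ ∈ G.boundaries (ZMod 2) Set.univ
  have hKmem : ∀ v, v ∈ K ↔
      Pi.single v (1 : ZMod 2) - (1 : V → ZMod 2) v • x₀ ∈ G.boundaries (ZMod 2) Set.univ := by
    simp [K]
  have hclosed : ∀ e, (G.s e ∈ K ↔ G.t e ∈ K) := by
    intro e
    rw [hKmem, hKmem]
    refine G.single_sub_smul_mem_boundaries_iff (Set.mem_univ e) _ x₀ ?_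
    rcases Int.units_eq_one_or (G.σ e) with a | a <;>
      rcases Int.units_eq_one_or (G.τ e) with b | b <;> simp only [coef, a, b, Pi.one_apply] <;> decide
  have hrK : r ∈ K := (hKmem r).2 (by simp [x₀])
  have hend : ∀ e v, G.s e = v ∨ G.t e = v → (v ∈ K ↔ G.s e ∈ K) := by
    rintro e v (rfl | rfl)
    · rfl
    · exact (hclosed e).symm
  have hall : ∀ e, ¬ G.Trivial e → G.s e ∈ K := by
    refine (hG K hclosed).resolve_right fun h => ?_
    obtain ⟨e, he, he'⟩ := hT r hr
    exact h e he ((hend e r he').1 hrK)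
  have hTK : ∀ v ∉ K, T v = 0 := fun v hv => by
    by_contra h
    obtain ⟨e, he, he'⟩ := hT v h
    exact hv ((hend e v he').2 (hall e he))
  have h := Submodule.sum_mem _ fun v hv => Submodule.smul_mem _ (T v) ((hKmem v).1 hv)
  obtain ⟨m, -, hm⟩ := G.mem_boundaries.1 h
  have hm' : ∀ v, G.bd (ZMod 2) m v = T v - (∑ v ∈ K, T v) * x₀ v := by
    intro v
    have : (if v ∈ K then T v else 0) = T v := by
      split_ifs with h
      · rfl
      · exact (hTK v h).symm
    rw [hm]
    simp [Finset.sum_apply, Pi.single_apply, mul_sub, Finset.sum_sub_distrib, Finset.sum_mul, this]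
  have hcases : ∀ z : ZMod 2, z = 0 ∨ z = 1 := by decide
  rcases hcases (∑ v ∈ K, T v) with h | h
  · exact ⟨m, 0, Or.inl rfl, fun v => by simp [hm', h]⟩
  · refine ⟨m, Pi.single r 1, Or.inr ⟨r, rfl⟩, fun v => ?_⟩
    rw [hm', h]
    simp only [x₀, Pi.single_apply]
    split_ifs
    · generalize T v = z
      revert z; decide
    · simp

/-- A lift of an even edge set to the double cover, with almost no boundary. -/
lemma EdgeConnected.exists_cover_flow [Fintype V] (hG : G.EdgeConnected) (B : E → ZMod 2)
    (hB : G.bd (ZMod 2) B = 0) :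
    ∃ (a : E × Bool → ℤ) (r : V → ℤ), (r = 0 ∨ ∃ v, r = Pi.single v 1) ∧
      (∀ f, -1 ≤ a f ∧ a f ≤ 1) ∧
      (∀ e, B e ≠ 0 → a (e, false) + a (e, true) = 1 ∨ a (e, false) + a (e, true) = -1) ∧
      ∀ v (κ : ℤˣ), netInflow G.coverSrc G.coverTgt a (v, κ) = κ * r v := by
  classical
  have hcases : ∀ z : ZMod 2, z = 0 ∨ z = 1 := by decide
  -- the part of `B` at the end with sign `κ`
  let b₀ : E → ℤ := fun e => (B e).val
  have hb₀ : ∀ e, ((b₀ e : ℤ) : ZMod 2) = B e := fun e => by simp [b₀]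
  let y₀ : E × Bool → ℤ := fun f => if f.2 then 0 else b₀ f.1
  have hdiff : ∀ v, ((netInflow G.coverSrc G.coverTgt y₀ (v, -1) : ℤ) : ZMod 2) =
      netInflow G.coverSrc G.coverTgt y₀ (v, 1) := by
    intro v
    have h := congr_arg (Int.cast : ℤ → ZMod 2) (G.netInflow_cover_sub y₀ v)
    rw [← bd_intCast] at h
    simp only [y₀, if_true, add_zero, Bool.false_eq_true, if_false, hb₀] at h
    rw [show (fun e => B e) = B from rfl, hB] at h
    rw [Int.cast_sub, Pi.zero_apply, sub_eq_zero] at h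
    exact h.symm
  obtain ⟨m, r, hr, hm⟩ := hG.exists_bd_zmod_two
    (fun v => ((netInflow G.coverSrc G.coverTgt y₀ (v, 1) : ℤ) : ZMod 2)) (fun v hv => by
      by_contra! hcon
      refine hv ?_
      rw [netInflow, Fintype.sum_prod_type, Int.cast_sum]
      refine Finset.sum_eq_zero fun e _ => ?_
      by_cases he : G.Trivial e
      · simp [y₀, coverSrc, coverTgt, he.1, he.2]
      · have := hcon e he
        simp [y₀, coverSrc, coverTgt, this.1, this.2])
  let m₀ : E → ℤ := fun e => (m e).val
  have hm₀ : ∀ e, ((m₀ e : ℤ) : ZMod 2) = m e := fun e => by simp [m₀]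
  let p : E × Bool → ZMod 2 := fun f => (y₀ f : ZMod 2) + m f.1
  let c : E × Bool → ℤ := fun f => if p f = 0 then 0 else 1
  have hcp : ∀ f, ((c f : ℤ) : ZMod 2) = p f := fun f => by
    rcases hcases (p f) with h | h <;> simp [c, h]
  have hc : ∀ f, c f = 0 ∨ c f = 1 := fun f => by dsimp only [c]; split_ifs <;> simp
  have hrr : ∀ v, r v = 0 ∨ r v = 1 := fun v => by
    rcases hr with rfl | ⟨w, rfl⟩
    · simp
    · simp only [Pi.single_apply]; split_ifs <;> simp
  have hbmod : ∀ w : V × ℤˣ, ((2 : ℕ) : ℤ) ∣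
      (w.2 : ℤ) * r w.1 - netInflow G.coverSrc G.coverTgt (fun f => -c f) w := by
    rintro ⟨v, κ⟩
    have h₁ : ((netInflow G.coverSrc G.coverTgt (fun f => -c f) (v, κ) : ℤ) : ZMod 2) =
        ((netInflow G.coverSrc G.coverTgt y₀ (v, κ) +
          netInflow G.coverSrc G.coverTgt (fun f => m₀ f.1) (v, κ) : ℤ) : ZMod 2) := by
      simp only [netInflow, ← Finset.sum_add_distrib, Int.cast_sum, ← add_mul, Int.cast_mul]
      refine Finset.sum_congr rfl fun f _ => ?_
      congr 1
      rw [Int.cast_neg, hcp, ZMod.neg_eq_self_mod_two, Int.cast_add, hm₀]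
    have h₂ : ((netInflow G.coverSrc G.coverTgt y₀ (v, κ) : ℤ) : ZMod 2) =
        netInflow G.coverSrc G.coverTgt y₀ (v, 1) := by
      rcases Int.units_eq_one_or κ with rfl | rfl
      · rfl
      · exact hdiff v
    have h₃ : (((κ : ℤ) : ℤ) : ZMod 2) = 1 := by
      rcases Int.units_eq_one_or κ with rfl | rfl <;> decide
    rw [← ZMod.intCast_zmod_eq_zero_iff_dvd, Int.cast_sub, h₁, Int.cast_add, h₂,
      netInflow_cover_fst, Int.cast_mul, Int.cast_mul, h₃, ← bd_intCast]
    simp only [hm₀]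
    rw [show (fun e => m e) = m from rfl, hm]
    generalize ((netInflow G.coverSrc G.coverTgt y₀ (v, 1) : ℤ) : ZMod 2) = z₁
    generalize ((r v : ℤ) : ZMod 2) = z₂
    revert z₁ z₂; decide
  have hmod : ∀ f, ((2 : ℕ) : ℤ) ∣ c f - -c f := fun f => ⟨c f, by push_cast; ring⟩
  obtain ⟨a, ha, ha'⟩ := exists_netInflow_eq_of_modEq G.coverSrc G.coverTgt (2 : ℕ) (by simp)
    (fun w => (w.2 : ℤ) * r w.1) (by simp [Fintype.sum_prod_type]) (fun f => -c f) c
    (fun f => by rcases hc f with h | h <;> simp [h]) hmod hbmod (fun S => by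
      have h₁ := dvd_cutCapacity_sub G.coverSrc G.coverTgt _ _ _ _ hmod hbmod S
      have h₂ : 0 ≤ cutCapacity G.coverSrc G.coverTgt (fun f => -c f) c S := by
        refine Finset.sum_nonneg fun f _ => ?_
        rcases hc f with h | h <;> simp only [h] <;> split_ifs <;> simp
      have h₃ : ∑ w ∈ S, (w.2 : ℤ) * r w.1 ≤ 1 := by
        rcases hr with rfl | ⟨v, rfl⟩
        · simp
        · rw [sum_sign_mul]
          simp only [Pi.single_apply, ite_mul, one_mul, zero_mul, Finset.sum_ite_eq', Finset.mem_univ]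
          split_ifs <;> simp
      push_cast at h₁
      omega)
  refine ⟨a, r, hr, fun f => ?_, fun e he => ?_, fun v κ => ha' (v, κ)⟩
  · have := ha f
    rcases hc f with h | h <;> rw [h] at this <;> omega
  · have h₁ := ha (e, false)
    have h₂ := ha (e, true)
    have hB1 : B e = 1 := (hcases _).resolve_left he
    rcases hcases (m e) with h | h
    · have c₁ : c (e, false) = 1 := by simp [c, p, y₀, hb₀, hB1, h]
      have c₂ : c (e, true) = 0 := by simp [c, p, y₀, h]
      rw [c₁] at h₁
      rw [c₂] at h₂
      push_cast at h₁ h₂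
      omega
    · have c₁ : c (e, false) = 0 := by
        simp only [c, p, y₀, hb₀, hB1, h, Bool.false_eq_true, if_false]; decide
      have c₂ : c (e, true) = 1 := by simp [c, p, y₀, h]
      rw [c₁] at h₁
      rw [c₂] at h₂
      push_cast at h₁ h₂
      omega

/-- The values allowed modulo three on an arc with residue `z`, where `a` is the value of the
even lift on the arc and `f` its total on the two copies of the edge. -/
def lowerBound (z : ZMod 3) (a f : ℤ) : ℤ :=
  if z = 0 then (if f = 1 then 3 * a else 3 * a - 3) else if z = 1 then -5 else -4

/-- The upper bound matching `lowerBound`. -/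
def upperBound (z : ZMod 3) (a f : ℤ) : ℤ :=
  if z = 0 then (if f = 1 then 3 * a + 3 else 3 * a) else if z = 1 then 4 else 5

lemma lowerBound_cast (z : ZMod 3) (a f : ℤ) : ((lowerBound z a f : ℤ) : ZMod 3) = z := by
  have h3 : (3 : ZMod 3) = 0 := by decide
  have hz : z = 0 ∨ z = 1 ∨ z = 2 := by revert z; decide
  rcases hz with rfl | rfl | rfl
  · simp only [lowerBound, if_true]
    split_ifs <;> simp [h3]
  · simp [lowerBound]; decide
  · rw [lowerBound, if_neg (by decide), if_neg (by decide)]; decide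

lemma three_dvd_upperBound_sub (z : ZMod 3) (a f : ℤ) :
    (3 : ℤ) ∣ upperBound z a f - lowerBound z a f := by
  simp only [lowerBound, upperBound]
  split_ifs <;> norm_num

lemma lowerBound_le (z : ZMod 3) (a f : ℤ) (ha : a ≤ 1) (ha' : -1 ≤ a) :
    lowerBound z a f ≤ 3 * a ∧ (lowerBound z a f = 3 * a → z = 0 ∧ f = 1) := by
  simp only [lowerBound]
  split_ifs <;> simp_all <;> omega

lemma le_upperBound (z : ZMod 3) (a f : ℤ) (ha : a ≤ 1) (ha' : -1 ≤ a) :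
    3 * a ≤ upperBound z a f ∧ (upperBound z a f = 3 * a → z = 0 ∧ f ≠ 1) := by
  simp only [upperBound]
  split_ifs <;> simp_all <;> omega

/-- A nowhere-zero integer flow with values at most ten on a bidirected graph which is
connected and has no small cuts. -/
lemma exists_flow_of_noSmallCut [Fintype V] (hG : G.NoSmallCut) (hconn : G.EdgeConnected) :
    ∃ h : E → ℤ, G.bd ℤ h = 0 ∧ ∀ e, h e ≠ 0 ∧ |h e| ≤ 10 := by
  classical
  obtain ⟨B, ψ, hB, hψ, hcov⟩ := hG.exists_cover
  obtain ⟨a, r, hr, ha, haB, hbd⟩ := hconn.exists_cover_flow B hB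
  let f : E → ℤ := fun e => a (e, false) + a (e, true)
  let l : E × Bool → ℤ := fun x => lowerBound (ψ x.1) (a x) (f x.1)
  let u : E × Bool → ℤ := fun x => upperBound (ψ x.1) (a x) (f x.1)
  have hl : ∀ x, l x ≤ 3 * a x ∧ (l x = 3 * a x → ψ x.1 = 0 ∧ f x.1 = 1) := fun x =>
    lowerBound_le _ _ _ (ha x).2 (ha x).1
  have hu : ∀ x, 3 * a x ≤ u x ∧ (u x = 3 * a x → ψ x.1 = 0 ∧ f x.1 ≠ 1) := fun x =>
    le_upperBound _ _ _ (ha x).2 (ha x).1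
  have hf : ∀ e, ψ e = 0 → f e = 1 ∨ f e = -1 := fun e he =>
    haB e ((hcov e).resolve_right (not_not.2 he))
  have hmod : ∀ x, (3 : ℤ) ∣ u x - l x := fun x => three_dvd_upperBound_sub _ _ _
  have hbmod : ∀ w, (3 : ℤ) ∣ (0 : V × ℤˣ → ℤ) w - netInflow G.coverSrc G.coverTgt l w := by
    rintro ⟨v, κ⟩
    have h₁ : ((netInflow G.coverSrc G.coverTgt l (v, κ) : ℤ) : ZMod 3) =
        ((netInflow G.coverSrc G.coverTgt (fun x => ((ψ x.1).val : ℤ)) (v, κ) : ℤ) : ZMod 3) := by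
      simp only [netInflow, Int.cast_sum, Int.cast_mul]
      refine Finset.sum_congr rfl fun x _ => ?_
      congr 1
      simp [l, lowerBound_cast]
    have h₂ := G.netInflow_cover_fst (fun e => ((ψ e).val : ℤ)) v κ
    have h₃ : (((0 : V × ℤˣ → ℤ) (v, κ) - netInflow G.coverSrc G.coverTgt l (v, κ) : ℤ) :
        ZMod 3) = 0 := by
      have hval : (fun e => (((ψ e).val : ℤ) : ZMod 3)) = ψ := funext fun e => by simp
      rw [Int.cast_sub, h₁, h₂, Int.cast_mul, ← bd_intCast, hval, hψ]
      simp
    exact (ZMod.intCast_zmod_eq_zero_iff_dvd _ 3).1 h₃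
  obtain ⟨y, hy, hy0⟩ := exists_netInflow_eq_of_modEq G.coverSrc G.coverTgt 3 (by simp)
    (0 : V × ℤˣ → ℤ) (by simp) l u (fun x => (hl x).1.trans (hu x).1) hmod hbmod (fun S => by
      have hdvd := dvd_cutCapacity_sub G.coverSrc G.coverTgt 3 0 l u hmod hbmod S
      simp only [Pi.zero_apply, Finset.sum_const_zero, sub_zero] at hdvd ⊢
      by_contra! hneg
      let β : V → ℤ := fun v => (if (v, 1) ∈ S then 1 else 0) - (if (v, -1) ∈ S then 1 else 0)
      have hβ : ∀ v, |β v| ≤ 1 := fun v => by dsimp only [β]; split_ifs <;> simp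
      have hP : ∑ w ∈ S, netInflow G.coverSrc G.coverTgt a w = ∑ v, r v * β v := by
        rw [← sum_sign_mul]
        exact Finset.sum_congr rfl fun w _ => hbd w.1 w.2
      have hP' : -1 ≤ ∑ v, r v * β v := by
        rcases hr with rfl | ⟨v, rfl⟩
        · simp
        · have := abs_le.1 (hβ v)
          simpa [Pi.single_apply] using this.1
      let ρ : E × Bool → ℤ := fun x => if G.coverTgt x ∈ S then
          (if G.coverSrc x ∈ S then 0 else u x - 3 * a x)
        else (if G.coverSrc x ∈ S then 3 * a x - l x else 0)
      have hρ : ∀ x ∈ Finset.univ, 0 ≤ ρ x := fun x _ => by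
        have h₁ := (hl x).1
        have h₂ := (hu x).1
        dsimp only [ρ]
        split_ifs <;> linarith
      have hcap : cutCapacity G.coverSrc G.coverTgt l u S =
          3 * ∑ v, r v * β v + ∑ x, ρ x := by
        rw [← hP, sum_netInflow, Finset.mul_sum, ← Finset.sum_add_distrib, cutCapacity]
        refine Finset.sum_congr rfl fun x _ => ?_
        dsimp only [ρ]
        split_ifs <;> ring
      have hρ0 := Finset.sum_nonneg hρ
      have hρ1 : ∑ x, ρ x = 0 := by omega
      have hP1 : ∑ v, r v * β v = -1 := by omega
      have hρx : ∀ x, ρ x = 0 := fun x =>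
        (Finset.sum_eq_zero_iff_of_nonneg hρ).1 hρ1 x (Finset.mem_univ x)
      have hin : ∀ x, G.coverTgt x ∈ S → G.coverSrc x ∉ S → f x.1 = -1 := fun x h₁ h₂ => by
        have h := hρx x
        simp only [ρ, if_pos h₁, if_neg h₂] at h
        have h' := (hu x).2 (by linarith)
        exact (hf _ h'.1).resolve_left h'.2
      have hout : ∀ x, G.coverTgt x ∉ S → G.coverSrc x ∈ S → f x.1 = 1 := fun x h₁ h₂ => by
        have h := hρx x
        simp only [ρ, if_neg h₁, if_pos h₂] at h
        exact ((hl x).2 (by linarith)).2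
      have habs : ∀ e, |G.coef β e| = -(f e * G.coef β e) := by
        intro e
        rw [show G.coef β e = _ from G.coef_coverCut S e, Fintype.sum_bool]
        have h₁ := hin (e, true)
        have h₂ := hin (e, false)
        have h₃ := hout (e, true)
        have h₄ := hout (e, false)
        dsimp only at h₁ h₂ h₃ h₄
        by_cases c₁ : G.coverTgt (e, true) ∈ S <;> by_cases c₂ : G.coverTgt (e, false) ∈ S <;>
          by_cases c₃ : G.coverSrc (e, true) ∈ S <;> by_cases c₄ : G.coverSrc (e, false) ∈ S <;>
          simp only [c₁, c₂, c₃, c₄, not_true_eq_false, not_false_eq_true, forall_const,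
            IsEmpty.forall_iff, if_true, if_false] at h₁ h₂ h₃ h₄ ⊢ <;>
          first
          | (rw [h₁] at h₄; omega)
          | (rw [h₂] at h₃; omega)
          | (rw [h₁]; norm_num)
          | (rw [h₂]; norm_num)
          | (rw [h₃]; norm_num)
          | (rw [h₄]; norm_num)
          | norm_num
      refine (hG β hβ).2 ?_
      have h₁ : ∑ e, f e * G.coef β e = 2 * ∑ v, r v * β v := by
        rw [← sum_mul_bd, Finset.mul_sum]
        refine Finset.sum_congr rfl fun v _ => ?_
        rw [← netInflow_cover_sub, hbd, hbd]
        push_cast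
        ring
      rw [Finset.sum_congr rfl fun e _ => habs e, Finset.sum_neg_distrib, h₁, hP1]
      norm_num)
  refine ⟨fun e => y (e, false) + y (e, true), ?_, fun e => ?_⟩
  · ext v
    rw [← netInflow_cover_sub, hy0, hy0]
    simp
  · change y (e, false) + y (e, true) ≠ 0 ∧ |y (e, false) + y (e, true)| ≤ 10
    have h₁ := hy (e, false)
    have h₂ := hy (e, true)
    have a₁ := ha (e, false)
    have a₂ := ha (e, true)
    simp only [l, u, lowerBound, upperBound] at h₁ h₂
    by_cases h0 : ψ e = 0
    · have hfe := hf e h0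
      simp only [if_pos h0] at h₁ h₂
      rw [abs_le]
      rcases hfe with h | h <;> simp only [h] at h₁ h₂ <;> simp only [f] at h <;>
        norm_num at h₁ h₂ <;> refine ⟨?_, ?_, ?_⟩ <;> omega
    · simp only [if_neg h0] at h₁ h₂
      rw [abs_le]
      split_ifs at h₁ h₂ <;> refine ⟨?_, ?_, ?_⟩ <;> omega

end BidirectedGraph

namespace BidirectedGraph

variable {V E : Type*} (G : BidirectedGraph V E)

/-- The graph in which every edge outside `P` becomes a positive loop. -/
def restrict (P : E → Prop) [DecidablePred P] : BidirectedGraph V E where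
  s := G.s
  t x := if P x then G.t x else G.s x
  σ := G.σ
  τ x := if P x then G.τ x else -G.σ x

lemma trivial_restrict_iff {P : E → Prop} [DecidablePred P] {e : E} :
    (G.restrict P).Trivial e ↔ (P e → G.Trivial e) := by
  by_cases h : P e <;> simp [restrict, Trivial, h]

variable [DecidableEq V]

section Contraction

/-- The graph in which `e` is contracted to its first end, after switching at its second end
where needed to make `e` positive. -/
def contract (e : E) : BidirectedGraph V E where
  s x := if G.s x = G.t e then G.s e else G.s x
  t x := if G.t x = G.t e then G.s e else G.t x
  σ x := if G.s x = G.t e then -(G.σ e * G.τ e) * G.σ x else G.σ x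
  τ x := if G.t x = G.t e then -(G.σ e * G.τ e) * G.τ x else G.τ x

variable {G}

lemma trivial_contract_self {e : E} (he : G.s e ≠ G.t e) : (G.contract e).Trivial e := by
  constructor
  · simp [contract]
  · rcases Int.units_eq_one_or (G.σ e) with h | h <;>
      rcases Int.units_eq_one_or (G.τ e) with h' | h' <;>
      simp [contract, h, h', he]

lemma Trivial.contract {e x : E} (hx : G.Trivial x) : (G.contract e).Trivial x := by
  obtain ⟨h₁, h₂⟩ := hx
  constructor
  · simp [BidirectedGraph.contract, h₁]
  · simp only [BidirectedGraph.contract, h₁, h₂]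
    split_ifs <;> simp

lemma inc_contract {e : E} (he : G.s e ≠ G.t e) (x : E) (v : V) :
    (G.contract e).inc x v = if v = G.t e then 0 else if v = G.s e then
      G.inc x v - (G.σ e : ℤ) * G.τ e * G.inc x (G.t e) else G.inc x v := by
  simp only [inc, contract]
  by_cases h₁ : G.s x = G.t e <;> by_cases h₂ : G.t x = G.t e <;>
    by_cases h₃ : v = G.t e <;> by_cases h₄ : v = G.s e <;>
    simp [h₁, h₂, h₃, h₄, he, he.symm, eq_comm (a := G.s e), eq_comm (b := v)] <;> ring

variable [Fintype E]

lemma bd_contract {e : E} (he : G.s e ≠ G.t e) (φ : E → ℤ) (v : V) :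
    (G.contract e).bd ℤ φ v = if v = G.t e then 0 else if v = G.s e then
      G.bd ℤ φ v - (G.σ e : ℤ) * G.τ e * G.bd ℤ φ (G.t e) else G.bd ℤ φ v := by
  simp only [bd_apply, inc_contract he]
  split_ifs
  · simp
  · rw [Finset.mul_sum, ← Finset.sum_sub_distrib]
    exact Finset.sum_congr rfl fun x _ => by simp only [Int.cast_id]; ring
  · rfl

lemma bd_contract_eq_zero {e : E} (he : G.s e ≠ G.t e) {φ : E → ℤ} (hφ : G.bd ℤ φ = 0) :
    (G.contract e).bd ℤ φ = 0 := by
  ext v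
  simp [bd_contract he, hφ]

/-- A flow of the contraction extends over the contracted edge. -/
lemma exists_bd_eq_zero_of_contract {e : E} (he : G.s e ≠ G.t e) {φ : E → ℤ}
    (hφ : (G.contract e).bd ℤ φ = 0) :
    ∃ ψ : E → ℤ, G.bd ℤ ψ = 0 ∧ ∀ x, x ≠ e → ψ x = φ x := by
  classical
  refine ⟨φ - ((G.τ e : ℤ) * G.bd ℤ φ (G.t e)) • Pi.single e 1, ?_, fun x hx => by simp [hx]⟩
  ext v
  have h := congrFun hφ v
  have hτ : (G.τ e : ℤ) * G.τ e = 1 := units_mul_self_cast (A := ℤ) (G.τ e)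
  rw [bd_contract he, Pi.zero_apply] at h
  rw [map_sub, map_smul, bd_single]
  simp only [Pi.sub_apply, Pi.smul_apply, Pi.add_apply, Pi.zero_apply, Pi.single_apply,
    smul_eq_mul, Int.cast_id]
  by_cases h₁ : v = G.t e
  · subst h₁
    simp only [if_neg he.symm, if_true]
    linear_combination -(G.bd ℤ φ (G.t e)) * hτ
  · by_cases h₂ : v = G.s e
    · subst h₂
      simp only [if_neg he, if_true] at h ⊢
      linear_combination h
    · simpa [h₁, h₂] using h

end Contraction

variable [Fintype E]

lemma sum_mul_coef_eq_zero [Fintype V] {φ : E → ℤ} (hφ : G.bd ℤ φ = 0) (β : V → ℤ) :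
    ∑ e, φ e * G.coef β e = 0 := by
  rw [← sum_mul_bd, hφ]
  simp

/-- A small cut in a graph with a nowhere-zero flow consists of two edges. -/
lemma exists_pair_of_not_noSmallCut [Fintype V] {φ : E → ℤ} (hφ : G.bd ℤ φ = 0)
    (hφ0 : ∀ e, φ e ≠ 0) (hG : ¬ G.NoSmallCut) :
    ∃ e e' : E, e ≠ e' ∧ G.s e ≠ G.t e ∧ ∀ ψ : E → ℤ, G.bd ℤ ψ = 0 → |ψ e| = |ψ e'| := by
  classical
  simp only [NoSmallCut, not_forall, not_and_or, not_not] at hG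
  obtain ⟨β, -, hsum⟩ := hG
  obtain ⟨e, he⟩ : ∃ e, G.coef β e ≠ 0 := by
    by_contra! h
    simp [h] at hsum
  obtain ⟨e', hne, he'⟩ : ∃ e', e' ≠ e ∧ G.coef β e' ≠ 0 := by
    by_contra! h
    have := G.sum_mul_coef_eq_zero hφ β
    rw [Fintype.sum_eq_single e fun x hx => by simp [h x hx]] at this
    exact mul_ne_zero (hφ0 e) he this
  have hrest : ∀ f : E → ℤ, ∑ x, f x = f e + (f e' + ∑ x ∈ (univ.erase e).erase e', f x) :=
    fun f => by
      rw [Finset.add_sum_erase _ f (by simp [hne]), Finset.add_sum_erase _ f (by simp)]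
  have hpos := Int.one_le_abs he
  have hpos' := Int.one_le_abs he'
  have hnonneg : 0 ≤ ∑ x ∈ (univ.erase e).erase e', |G.coef β x| :=
    Finset.sum_nonneg fun _ _ => abs_nonneg _
  rw [hrest] at hsum
  have hzero : ∑ x ∈ (univ.erase e).erase e', |G.coef β x| = 0 := by omega
  have h₁ : |G.coef β e| = 1 := by omega
  have h₂ : |G.coef β e'| = 1 := by omega
  rw [Finset.sum_eq_zero_iff_of_nonneg fun _ _ => abs_nonneg _] at hzero
  refine ⟨e, e', hne.symm, fun hst => ?_, fun ψ hψ => ?_⟩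
  · rw [coef, hst, abs_eq zero_le_one] at h₁
    rcases Int.units_eq_one_or (G.σ e) with h | h <;>
      rcases Int.units_eq_one_or (G.τ e) with h' | h' <;> simp [h, h'] at h₁ <;> omega
  · have h := G.sum_mul_coef_eq_zero hψ β
    rw [hrest, Finset.sum_eq_zero fun x hx => by rw [abs_eq_zero.1 (hzero x hx), mul_zero],
      add_zero] at h
    have h' := congrArg abs (eq_neg_of_add_eq_zero_left h)
    simpa [abs_mul, h₁, h₂] using h'

variable {G} in
lemma bd_restrict {P : E → Prop} [DecidablePred P] (φ : E → ℤ) :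
    (G.restrict P).bd ℤ φ = G.bd ℤ fun e => if P e then φ e else 0 := by
  ext v
  simp only [bd_apply]
  refine Finset.sum_congr rfl fun e _ => ?_
  by_cases h : P e
  · simp only [restrict, inc, if_pos h]
    congr!
  · rw [inc_of_trivial _ (by simp [restrict, Trivial, h])]
    simp [h]

/-- Nowhere-zero integer flows of bidirected graphs can be taken with small values. -/
theorem exists_flow_abs_le_ten [Fintype V] {φ : E → ℤ} (hφ : G.bd ℤ φ = 0) (hφ0 : ∀ e, φ e ≠ 0) :
    ∃ h : E → ℤ, G.bd ℤ h = 0 ∧ ∀ e, h e ≠ 0 ∧ |h e| ≤ 10 := by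
  classical
  induction hn : #{e | ¬ G.Trivial e} using Nat.strong_induction_on generalizing G with
  | _ n ih =>
    subst hn
    by_cases hcut : G.NoSmallCut
    swap
    · obtain ⟨e, e', hne, hst, habs⟩ := G.exists_pair_of_not_noSmallCut hφ hφ0 hcut
      obtain ⟨h', hbd, hh'⟩ := ih _ (Finset.card_lt_card ((Finset.ssubset_iff_of_subset
        (Finset.monotone_filter_right _ fun x _ hx hx' => hx hx'.contract)).2
        ⟨e, by simpa using fun h : G.Trivial e => hst h.1,
          by simpa using trivial_contract_self hst⟩)) (G.contract e) (bd_contract_eq_zero hst hφ) rfl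
      obtain ⟨h, hh, heq⟩ := exists_bd_eq_zero_of_contract hst hbd
      refine ⟨h, hh, fun x => ?_⟩
      by_cases hx : x = e
      · subst hx
        rw [← abs_pos, habs h hh, heq _ hne.symm, abs_pos]
        exact hh' e'
      · rw [heq x hx]
        exact hh' x
    by_cases hconn : G.EdgeConnected
    · exact G.exists_flow_of_noSmallCut hcut hconn
    simp only [EdgeConnected, not_forall, not_or] at hconn
    obtain ⟨Y, hY, ⟨e₁, he₁, hY₁⟩, e₂, he₂, hY₂⟩ := hconn
    rw [not_not] at hY₂
    have hYφ : ∀ (f : E → ℤ), G.bd ℤ f = 0 →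
        G.bd ℤ (fun e => if G.s e ∈ Y then f e else 0) = 0 ∧
        G.bd ℤ (fun e => if G.s e ∉ Y then f e else 0) = 0 := fun f hf => by
      have h : G.bd ℤ (fun e => if G.s e ∈ Y then f e else 0) = 0 := by
        ext v
        rw [G.bd_ite_mem Y f fun e _ => hY e]
        simp [hf]
      refine ⟨h, ?_⟩
      rw [← sub_eq_zero_of_eq (hf.trans h.symm), ← map_sub]
      congr 1
      ext e
      by_cases he : G.s e ∈ Y <;> simp [he]
    have hlt : ∀ (P : E → Prop) [DecidablePred P] (e : E), ¬ P e → ¬ G.Trivial e →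
        #{x | ¬ (G.restrict P).Trivial x} < #{x | ¬ G.Trivial x} := fun P _ e hP he =>
      Finset.card_lt_card ((Finset.ssubset_iff_of_subset
        (Finset.monotone_filter_right _ fun x _ hx hx' =>
          hx (G.trivial_restrict_iff.2 fun _ => hx'))).2
        ⟨e, by simpa using he, by simpa [trivial_restrict_iff] using fun h => absurd h hP⟩)
    obtain ⟨g, hg, hg'⟩ := ih _ (hlt (fun e => G.s e ∈ Y) e₁ hY₁ he₁) _
      (by rw [bd_restrict]; exact (hYφ φ hφ).1) rfl
    obtain ⟨k, hk, hk'⟩ := ih _ (hlt (fun e => G.s e ∉ Y) e₂ (not_not.2 hY₂) he₂) _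
      (by rw [bd_restrict]; exact (hYφ φ hφ).2) rfl
    rw [bd_restrict] at hg hk
    refine ⟨fun e => if G.s e ∈ Y then g e else k e, ?_, fun e => ?_⟩
    · rw [← add_zero (0 : V → ℤ)]
      nth_rw 1 [← hg]
      rw [← hk, ← map_add]
      congr 1
      ext e
      by_cases he : G.s e ∈ Y <;> simp [he]
    · dsimp only
      split_ifs
      · exact hg' e
      · exact hk' e

end BidirectedGraph

namespace SignedMultigraph

variable {V E : Type} (G : SignedMultigraph V E)

/-- The half-edge sign of a direction. -/
def dirSign (b : Bool) : ℤˣ := if b then 1 else -1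

/-- The bidirected graph obtained by orienting a signed graph. -/
def orient (d : E → Bool × Bool) : BidirectedGraph V E where
  s e := (G.ends e).1
  t e := (G.ends e).2
  σ e := dirSign (d e).1
  τ e := dirSign (d e).2

lemma vertexSum_eq_bd [Fintype E] [DecidableEq V] (d : E → Bool × Bool) (φ : E → ℤ) (v : V) :
    G.vertexSum d φ v = (G.orient d).bd ℤ φ v := by
  simp only [vertexSum, BidirectedGraph.bd_apply, BidirectedGraph.inc, orient]
  refine Finset.sum_congr rfl fun e _ => ?_
  rcases d e with ⟨_ | _, _ | _⟩ <;> simp [dirSign, mul_add]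

end SignedMultigraph

open SignedMultigraph in
/-- DeVos: every flow-admissible signed graph admits a nowhere-zero 12-flow. -/
theorem stmt_7 {V E : Type} [Fintype V] [Fintype E] [DecidableEq V] [DecidableEq E]
    (G : SignedMultigraph V E) (h : G.FlowAdmissible) :
    G.HasNZkFlow 12 := by
  obtain ⟨d, φ, ⟨hd, hφ⟩, hφ0⟩ := h
  obtain ⟨f, hf, hf'⟩ := (G.orient d).exists_flow_abs_le_ten
    (funext fun v => (G.vertexSum_eq_bd d φ v).symm.trans (hφ v)) hφ0
  exact ⟨d, f, ⟨hd, fun v => (G.vertexSum_eq_bd d f v).trans (congrFun hf v)⟩,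
    fun e => ⟨abs_pos.2 (hf' e).1, (hf' e).2.trans_lt (by norm_num)⟩⟩
end

section
/- Every flow-admissible signed graph whose underlying graph is 4-edge-connected admits a nowhere-zero 4-flow. -/
open Finset

namespace SignedMultigraph

section Trails

variable {V E : Type} [DecidableEq E] {G : SignedMultigraph V E}

/-- `G.Trail F a b`: the edges of `F` can be arranged into a trail from `a` to `b`. -/
inductive Trail (G : SignedMultigraph V E) : Finset E → V → V → Prop
  | nil (a : V) : Trail G ∅ a a
  | cons {F : Finset E} {a b c : V} {e : E} : Trail G F a b → e ∉ F →
      (G.ends e = (b, c) ∨ G.ends e = (c, b)) → Trail G (insert e F) a c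

theorem Trail.append {F₁ F₂ : Finset E} {a b c : V}
    (h₁ : G.Trail F₁ a b) (h₂ : G.Trail F₂ b c) (hd : Disjoint F₁ F₂) :
    G.Trail (F₁ ∪ F₂) a c := by
  induction h₂ with
  | nil => simpa using h₁
  | cons _ he hends ih =>
    rw [Finset.disjoint_insert_right] at hd
    rw [Finset.union_insert]
    exact .cons (ih h₁ hd.2) (by simp [he, hd.1]) hends

theorem Trail.split {F : Finset E} {a b : V} (h : G.Trail F a b) :
    ∀ v, v = b ∨ v ∈ G.supp F → ∃ F₁ F₂, Disjoint F₁ F₂ ∧ F₁ ∪ F₂ = F ∧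
      G.Trail F₁ a v ∧ G.Trail F₂ v b := by
  induction h with
  | nil a =>
    rintro v (rfl | ⟨e, he, -⟩)
    · exact ⟨∅, ∅, by simp, by simp, .nil _, .nil _⟩
    · simp at he
  | @cons F a b c e hF he hends ih =>
    intro v hv
    by_cases hvc : v = c
    · subst hvc
      exact ⟨insert e F, ∅, by simp, by simp, .cons hF he hends, .nil _⟩
    have hv' : v = b ∨ v ∈ G.supp F := by
      rcases hv with hv | ⟨f, hf, hfv⟩
      · exact absurd hv hvc
      rcases Finset.mem_insert.1 hf with rfl | hf
      · left
        rcases hends with h | h <;> rw [h] at hfv <;> simp only at hfv <;>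
          rcases hfv with h | h <;> first | exact h.symm | exact absurd h.symm hvc
      · exact Or.inr ⟨f, hf, hfv⟩
    obtain ⟨F₁, F₂, hd, rfl, h₁, h₂⟩ := ih v hv'
    rw [Finset.mem_union, not_or] at he
    refine ⟨F₁, insert e F₂, ?_, ?_, h₁, .cons h₂ he.2 hends⟩
    · rw [Finset.disjoint_insert_right]
      exact ⟨he.1, hd⟩
    · rw [Finset.union_insert]

theorem Trail.rotate {F : Finset E} {a : V} (h : G.Trail F a a) {v : V}
    (hv : v ∈ G.supp F) : G.Trail F v v := by
  obtain ⟨F₁, F₂, hd, rfl, h₁, h₂⟩ := h.split v (Or.inr hv)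
  rw [Finset.union_comm]
  exact h₂.append h₁ hd.symm

variable [DecidableEq V]

theorem degIn_insert {F : Finset E} {e : E} (he : e ∉ F) (v : V) :
    G.degIn (insert e F) v = ((if (G.ends e).1 = v then 1 else 0) +
      (if (G.ends e).2 = v then 1 else 0)) + G.degIn F v :=
  Finset.sum_insert he

theorem Trail.even_degIn_iff {F : Finset E} {a b : V} (h : G.Trail F a b) (v : V) :
    Even (G.degIn F v) ↔ (a = v ↔ b = v) := by
  induction h with
  | nil => simp [degIn]
  | @cons F a b c e hF he hends ih =>
    rw [degIn_insert he, Nat.even_add, ih]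
    rcases hends with h | h <;> rw [h] <;> by_cases h1 : b = v <;> by_cases h2 : c = v <;>
      by_cases h3 : a = v <;> simp [h1, h2, h3]

/-- Euler's theorem: a connected set of edges with even degrees is a closed trail. -/
theorem exists_closed_trail [Nonempty V] {B : Finset E} (heven : ∀ v, Even (G.degIn B v))
    (hconn : ∀ v w, G.reach B v w) : ∃ a, G.Trail B a a := by
  classical
  obtain ⟨F, hF, hmax⟩ := (B.powerset.filter fun F => ∃ a b, G.Trail F a b).exists_max_image
    Finset.card ⟨∅, by
      simp only [Finset.mem_filter, Finset.empty_mem_powerset, true_and]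
      exact ⟨Classical.arbitrary V, _, .nil _⟩⟩
  simp only [Finset.mem_filter, Finset.mem_powerset] at hF hmax
  obtain ⟨hFB, a, b, hT⟩ := hF
  have hext : ∀ a b, G.Trail F a b → ∀ e ∈ B, ((G.ends e).1 = b ∨ (G.ends e).2 = b) → e ∈ F := by
    intro a b hT e he heb
    by_contra heF
    have key : ∀ c, (G.ends e = (b, c) ∨ G.ends e = (c, b)) → False := fun c hc => by
      have := hmax (insert e F) ⟨Finset.insert_subset he hFB, a, c, hT.cons heF hc⟩
      rw [Finset.card_insert_of_notMem heF] at this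
      omega
    rcases heb with h | h
    · exact key (G.ends e).2 (Or.inl (Prod.ext h rfl))
    · exact key (G.ends e).1 (Or.inr (Prod.ext rfl h))
  have hab : a = b := by
    by_contra hab
    have hdeg : G.degIn B b = G.degIn F b := by
      refine (Finset.sum_subset hFB fun e he heF => ?_).symm
      have := not_or.1 fun h => heF (hext a b hT e he h)
      simp [this.1, this.2]
    have := heven b
    rw [hdeg, hT.even_degIn_iff] at this
    exact hab (this.2 rfl)
  subst hab
  have hall : ∀ v, G.Trail F v v := by
    intro v
    have := hconn a v
    induction this with
    | refl => exact hT
    | @tail x y _ hxy ih =>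
      obtain ⟨e, he, hends⟩ := hxy
      have heF := hext x x ih e he (by rcases hends with h | h <;> simp [h])
      exact ih.rotate ⟨e, heF, by rcases hends with h | h <;> simp [h]⟩
  have : F = B := hFB.antisymm fun e he => hext _ _ (hall (G.ends e).1) e he (Or.inl rfl)
  exact ⟨a, this ▸ hT⟩

variable [Fintype E]

theorem vertexSum_update {d : E → Bool × Bool} {φ : E → ℤ} {e : E} (he : φ e = 0) (x : ℤ) (v : V) :
    G.vertexSum d (Function.update φ e x) v = G.vertexSum d φ v +
      ((if (G.ends e).1 = v then (if (d e).1 then x else -x) else 0) +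
        (if (G.ends e).2 = v then (if (d e).2 then x else -x) else 0)) := by
  unfold vertexSum
  rw [← Finset.add_sum_erase _ _ (Finset.mem_univ e),
    ← Finset.add_sum_erase univ (fun f => _ + _) (Finset.mem_univ e),
    Finset.sum_congr rfl fun f hf => by
      rw [Function.update_of_ne (Finset.ne_of_mem_erase hf)]]
  simp [he]
  ring

/-- The flow of value `±1` along a trail balances everywhere except at the two ends. -/
theorem Trail.exists_flow {d : E → Bool × Bool} (hd : G.IsOrientation d) {F : Finset E} {a b : V}
    (h : G.Trail F a b) : ∃ φ : E → ℤ, (∀ e ∈ F, |φ e| = 1) ∧ (∀ e ∉ F, φ e = 0) ∧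
      ∀ v, G.vertexSum d φ v = (if a = v then 1 else 0) -
        (if b = v then (-1) ^ (G.negEdges F).card else 0) := by
  induction h with
  | nil => exact ⟨fun _ => 0, by simp, by simp, by simp [vertexSum, negEdges]⟩
  | @cons F a b c e hF he hends ih =>
    obtain ⟨φ, h1, h0, hs⟩ := ih
    have hde := hd e
    have hneg : (-1 : ℤ) ^ (G.negEdges (insert e F)).card =
        (if (d e).1 = (d e).2 then -1 else 1) * (-1) ^ (G.negEdges F).card := by
      unfold negEdges
      rw [Finset.filter_insert]
      split_ifs with h h' h'
      · rw [Finset.card_insert_of_notMem (by simp [he]), pow_succ]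
        ring
      · exact absurd (hde.1 h) h'
      · exact absurd (hde.2 h') h
      · simp
    set p : ℤ := (-1) ^ (G.negEdges F).card with hp
    have hp1 : |p| = 1 := by simp [hp, abs_pow]
    have key : ∀ x : ℤ, |x| = 1 →
        (∀ v, p * (if b = v then 1 else 0) -
          p * (if c = v then (if (d e).1 = (d e).2 then -1 else 1) else 0) =
          ((if (G.ends e).1 = v then (if (d e).1 then x else -x) else 0) +
          (if (G.ends e).2 = v then (if (d e).2 then x else -x) else 0))) →
        ∃ φ : E → ℤ, (∀ f ∈ insert e F, |φ f| = 1) ∧ (∀ f ∉ insert e F, φ f = 0) ∧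
          ∀ v, G.vertexSum d φ v = (if a = v then 1 else 0) -
            (if c = v then (-1) ^ (G.negEdges (insert e F)).card else 0) := by
      intro x hx hxv
      refine ⟨Function.update φ e x, fun f hf => ?_, fun f hf => ?_, fun v => ?_⟩
      · by_cases hfe : f = e
        · subst hfe
          simpa using hx
        · rw [Function.update_of_ne hfe]
          exact h1 f ((Finset.mem_insert.1 hf).resolve_left hfe)
      · rw [Finset.mem_insert, not_or] at hf
        rw [Function.update_of_ne hf.1]
        exact h0 f hf.2
      · rw [vertexSum_update (h0 e he), ← hxv, hs, hneg]
        split_ifs <;> ring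
    rcases hends with h | h
    · refine key (if (d e).1 then p else -p) (by split_ifs <;> simp [hp1]) fun v => ?_
      rw [h]
      rcases d e with ⟨_ | _, _ | _⟩ <;> simp <;> split_ifs <;> ring
    · refine key (if (d e).2 then p else -p) (by split_ifs <;> simp [hp1]) fun v => ?_
      rw [h]
      rcases d e with ⟨_ | _, _ | _⟩ <;> simp <;> split_ifs <;> ring

/-- A connected even subgraph with an even number of negative edges carries a flow of
values `±1`. -/
theorem exists_unit_flow [Nonempty V] {d : E → Bool × Bool} (hd : G.IsOrientation d)
    {B : Finset E} (heven : ∀ v, Even (G.degIn B v)) (hconn : ∀ v w, G.reach B v w)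
    (hneg : Even (G.negEdges B).card) :
    ∃ φ : E → ℤ, (∀ e ∈ B, |φ e| = 1) ∧ (∀ e ∉ B, φ e = 0) ∧ ∀ v, G.vertexSum d φ v = 0 := by
  obtain ⟨a, ha⟩ := exists_closed_trail heven hconn
  obtain ⟨φ, h1, h0, hs⟩ := ha.exists_flow hd
  refine ⟨φ, h1, h0, fun v => ?_⟩
  rw [hs, hneg.neg_one_pow, sub_self]

end Trails
section Packing

/-- One step of Rado's argument for independent transversals, for a submodular rank function on a
lattice. -/
theorem rado_step {E L : Type*} [Fintype E] [DecidableEq E] [Lattice L] [OrderBot L]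
    {ρ : L → ℕ} (hmono : Monotone ρ) (hsub : ∀ x y, ρ (x ⊔ y) + ρ (x ⊓ y) ≤ ρ x + ρ y)
    {n : ℕ} {A : E → L} (hA : ∀ J : Finset E, n + J.card ≤ ρ (J.sup A) + Fintype.card E)
    {e : E} {p q : L} (hpq : A e = p ⊔ q) :
    (∀ J : Finset E, n + J.card ≤ ρ (J.sup (Function.update A e p)) + Fintype.card E) ∨
    (∀ J : Finset E, n + J.card ≤ ρ (J.sup (Function.update A e q)) + Fintype.card E) := by
  by_contra! hcon
  obtain ⟨⟨J, hJ⟩, K, hK⟩ := hcon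
  have hsup : ∀ (r : L) (J : Finset E),
      J.sup (Function.update A e r) = (if e ∈ J then r else ⊥) ⊔ (J.erase e).sup A := by
    intro r J
    have hne : (J.erase e).sup (Function.update A e r) = (J.erase e).sup A :=
      Finset.sup_congr rfl fun f hf => Function.update_of_ne (Finset.ne_of_mem_erase hf) ..
    split_ifs with he
    · rw [← hne]
      conv_lhs => rw [← Finset.insert_erase he, Finset.sup_insert, Function.update_self]
    · rw [Finset.erase_eq_of_notMem he] at hne ⊢
      rw [hne, bot_sup_eq]
  have hmem : ∀ (r : L) (J : Finset E),
      ρ (J.sup (Function.update A e r)) + Fintype.card E < n + J.card → e ∈ J := by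
    intro r J hJ
    by_contra he
    have := hA J
    rw [hsup, if_neg he, Finset.erase_eq_of_notMem he, bot_sup_eq] at hJ
    omega
  have heJ := hmem p J hJ
  have heK := hmem q K hK
  rw [hsup, if_pos heJ] at hJ
  rw [hsup, if_pos heK] at hK
  have h₁ := hA (J ∪ K)
  have h₂ := hA ((J ∩ K).erase e)
  have hle₁ : (J ∪ K).sup A ≤ (p ⊔ (J.erase e).sup A) ⊔ (q ⊔ (K.erase e).sup A) := by
    refine Finset.sup_le fun f hf => ?_
    by_cases hfe : f = e
    · subst hfe
      rw [hpq]
      exact sup_le_sup le_sup_left le_sup_left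
    · rcases Finset.mem_union.1 hf with h | h
      · exact (Finset.le_sup (f := A) (Finset.mem_erase.2 ⟨hfe, h⟩)).trans
          (le_sup_right.trans le_sup_left)
      · exact (Finset.le_sup (f := A) (Finset.mem_erase.2 ⟨hfe, h⟩)).trans
          (le_sup_right.trans le_sup_right)
  have hle₂ : ((J ∩ K).erase e).sup A ≤ (p ⊔ (J.erase e).sup A) ⊓ (q ⊔ (K.erase e).sup A) :=
    le_inf
      ((Finset.sup_mono (Finset.erase_subset_erase e Finset.inter_subset_left)).trans le_sup_right)
      ((Finset.sup_mono (Finset.erase_subset_erase e Finset.inter_subset_right)).trans le_sup_right)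
  have := hmono hle₁
  have := hmono hle₂
  have := hsub (p ⊔ (J.erase e).sup A) (q ⊔ (K.erase e).sup A)
  have := Finset.card_union_add_card_inter J K
  have heJK : e ∈ J ∩ K := Finset.mem_inter.2 ⟨heJ, heK⟩
  have := Finset.card_erase_of_mem heJK
  have := Finset.card_pos.2 ⟨e, heJK⟩
  omega

open Module in
/-- A vector family meeting the counting condition contains two disjoint spanning
subfamilies. -/
theorem exists_disjoint_spanning {K D E : Type*} [Field K] [AddCommGroup D] [Module K D]
    [FiniteDimensional K D] [Fintype E] [DecidableEq E] (v : E → D)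
    (hv : ∀ J : Finset E, 2 * finrank K (univ.sup fun e => K ∙ v e : Submodule K D) + J.card ≤
      2 * finrank K (J.sup fun e => K ∙ v e : Submodule K D) + Fintype.card E) :
    ∃ X : Finset E, (X.sup fun e => K ∙ v e) = (univ.sup fun e => K ∙ v e) ∧
      (Xᶜ.sup fun e => K ∙ v e) = (univ.sup fun e => K ∙ v e) := by
  set u : E → Submodule K D := fun e => K ∙ v e with hu
  set n := 2 * finrank K (univ.sup u : Submodule K D) with hn
  let ρ : Submodule K D × Submodule K D → ℕ := fun p => finrank K p.1 + finrank K p.2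
  have hmono : Monotone ρ := fun p q h =>
    add_le_add (Submodule.finrank_mono h.1) (Submodule.finrank_mono h.2)
  have hsub : ∀ x y, ρ (x ⊔ y) + ρ (x ⊓ y) ≤ ρ x + ρ y := fun x y => by
    have h₁ := Submodule.finrank_sup_add_finrank_inf_eq x.1 y.1
    have h₂ := Submodule.finrank_sup_add_finrank_inf_eq x.2 y.2
    simp only [ρ, Prod.fst_sup, Prod.snd_sup, Prod.fst_inf, Prod.snd_inf]
    omega
  let A : Finset E → Finset E → E → Submodule K D × Submodule K D := fun T X e =>
    if e ∈ T then (if e ∈ X then (u e, ⊥) else (⊥, u e)) else (u e, u e)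
  have key : ∀ T : Finset E, ∃ X : Finset E, ∀ J : Finset E,
      n + J.card ≤ ρ (J.sup (A T X)) + Fintype.card E := by
    intro T
    induction T using Finset.induction_on with
    | empty =>
      refine ⟨∅, fun J => (hv J).trans ?_⟩
      have hle : (J.sup u, J.sup u) ≤ J.sup fun e => (u e, u e) :=
        ⟨Finset.sup_le fun e he => (Finset.le_sup (f := fun e => (u e, u e)) he).1,
          Finset.sup_le fun e he => (Finset.le_sup (f := fun e => (u e, u e)) he).2⟩
      have := hmono hle
      simp only [ρ] at this
      simp only [A, Finset.notMem_empty, if_false, ρ]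
      omega
    | insert e T he ih =>
      obtain ⟨X, hX⟩ := ih
      rcases rado_step hmono hsub hX (e := e) (p := (u e, ⊥)) (q := (⊥, u e)) (by simp [A, he])
        with h | h
      · refine ⟨insert e X, ?_⟩
        have hA : A (insert e T) (insert e X) = Function.update (A T X) e (u e, ⊥) :=
          Function.eq_update_iff.2 ⟨by simp [A], fun f hf => by simp [A, hf]⟩
        rwa [hA]
      · refine ⟨X.erase e, ?_⟩
        have hA : A (insert e T) (X.erase e) = Function.update (A T X) e (⊥, u e) :=
          Function.eq_update_iff.2 ⟨by simp [A], fun f hf => by simp [A, hf]⟩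
        rwa [hA]
  obtain ⟨X, hX⟩ := key univ
  have hle : univ.sup (A univ X) ≤ (X.sup u, Xᶜ.sup u) := by
    refine Finset.sup_le fun e _ => ?_
    by_cases he : e ∈ X
    · simpa [A, he] using Finset.le_sup (f := u) he
    · simpa [A, he] using Finset.le_sup (f := u) (Finset.mem_compl.2 he)
  have h := (hX univ).trans (Nat.add_le_add_right (hmono hle) _)
  have h₁ : X.sup u ≤ univ.sup u := Finset.sup_mono (Finset.subset_univ _)
  have h₂ : Xᶜ.sup u ≤ univ.sup u := Finset.sup_mono (Finset.subset_univ _)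
  have hf₁ := Submodule.finrank_mono h₁
  have hf₂ := Submodule.finrank_mono h₂
  simp only [ρ, Finset.card_univ] at h
  exact ⟨X, Submodule.eq_of_le_of_finrank_eq h₁ (by omega),
    Submodule.eq_of_le_of_finrank_eq h₂ (by omega)⟩

theorem exists_sum_eq_of_mem_sup_span {D E : Type*} [AddCommGroup D] [Module (ZMod 2) D]
    [DecidableEq E] (v : E → D) (X : Finset E) :
    ∀ y ∈ X.sup (fun e => (ZMod 2) ∙ v e), ∃ S ⊆ X, y = ∑ e ∈ S, v e := by
  induction X using Finset.induction_on with
  | empty => intro y hy; exact ⟨∅, by simp, by simpa using hy⟩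
  | insert e X he ih =>
    intro y hy
    rw [Finset.sup_insert, Submodule.mem_sup] at hy
    obtain ⟨a, ha, b, hb, rfl⟩ := hy
    obtain ⟨S, hS, rfl⟩ := ih b hb
    obtain ⟨c, rfl⟩ := Submodule.mem_span_singleton.1 ha
    have hc : c = 0 ∨ c = 1 := by
      clear ha
      revert c
      decide
    rcases hc with rfl | rfl
    · exact ⟨S, hS.trans (Finset.subset_insert _ _), by simp⟩
    · exact ⟨insert e S, Finset.insert_subset_insert e hS,
        by rw [Finset.sum_insert fun h => he (hS h), one_smul]⟩

/-- Every set of vectors extends to a dependency by vectors of a spanning set. -/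
theorem exists_superset_sum_eq_zero {D E : Type*} [AddCommGroup D] [Module (ZMod 2) D]
    [Fintype E] [DecidableEq E] (v : E → D) {X : Finset E}
    (hX : X.sup (fun e => (ZMod 2) ∙ v e) = univ.sup fun e => (ZMod 2) ∙ v e) :
    ∃ B : Finset E, Xᶜ ⊆ B ∧ ∑ e ∈ B, v e = 0 := by
  obtain ⟨S, hS, h⟩ := exists_sum_eq_of_mem_sup_span v X (∑ e ∈ Xᶜ, v e) (by
    rw [hX]
    exact Submodule.sum_mem _ fun e _ => Finset.le_sup (f := fun e => (ZMod 2) ∙ v e)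
      (Finset.mem_univ e) (Submodule.mem_span_singleton_self _))
  refine ⟨Xᶜ ∪ S, Finset.subset_union_left, ?_⟩
  rw [Finset.sum_union (Finset.disjoint_left.2 fun e he he' => Finset.mem_compl.1 he (hS he')),
    ← h, ← two_smul (ZMod 2), show (2 : ZMod 2) = 0 from rfl, zero_smul]

end Packing
section EdgeVectors

open Module

variable {V E : Type} {G : SignedMultigraph V E}

theorem adj_symm {F : Finset E} {v w : V} (h : G.adj F v w) : G.adj F w v := by
  obtain ⟨e, he, h⟩ := h
  exact ⟨e, he, h.symm⟩

theorem reach_symm {F : Finset E} {v w : V} (h : G.reach F v w) : G.reach F w v :=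
  have : Std.Symm (G.adj F) := ⟨fun _ _ => adj_symm⟩
  Relation.ReflTransGen.stdSymm.symm _ _ h

theorem reach_equivalence (F : Finset E) : Equivalence (G.reach F) :=
  ⟨fun _ => .refl, reach_symm, Relation.ReflTransGen.trans⟩

theorem reach_mono {F F' : Finset E} (hF : F ⊆ F') {v w : V} (h : G.reach F v w) :
    G.reach F' v w :=
  Relation.ReflTransGen.mono (fun _ _ ⟨e, he, h⟩ => ⟨e, hF he, h⟩) _ _ h

theorem adj_ends {F : Finset E} {e : E} (he : e ∈ F) : G.adj F (G.ends e).1 (G.ends e).2 :=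
  ⟨e, he, Or.inl rfl⟩

/-- A function taking the same value at the ends of each edge of `F` is constant on the
components of `F`. -/
theorem eq_of_reach {α : Type*} {F : Finset E} {x : V → α}
    (hx : ∀ e ∈ F, x (G.ends e).1 = x (G.ends e).2) {v w : V} (h : G.reach F v w) :
    x v = x w := by
  induction h with
  | refl => rfl
  | tail _ h ih =>
    obtain ⟨e, he, h⟩ := h
    have := hx e he
    rcases h with h | h <;> rw [h] at this <;> simp_all

/-- The vector of an edge in the even-cycle matroid, as a functional sending a potential `x` on the
vertices and a scalar `s` to `x u + x w + s * σ`, where `σ` is the sign of the edge `uw`. -/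
def edgeVec (G : SignedMultigraph V E) (e : E) : Dual (ZMod 2) ((V → ZMod 2) × ZMod 2) :=
  let π (v : V) : (V → ZMod 2) →ₗ[ZMod 2] ZMod 2 := LinearMap.proj v
  (π (G.ends e).1 + π (G.ends e).2) ∘ₗ LinearMap.fst _ _ _ +
    (if G.neg e then (1 : ZMod 2) else 0) • LinearMap.snd _ _ _

theorem edgeVec_apply (e : E) (p : (V → ZMod 2) × ZMod 2) :
    G.edgeVec e p = p.1 (G.ends e).1 + p.1 (G.ends e).2 +
      (if G.neg e then (1 : ZMod 2) else 0) * p.2 := rfl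

/-- The span of the vectors of the edges in `J`. -/
def edgeSpan (G : SignedMultigraph V E) (J : Finset E) :
    Submodule (ZMod 2) (Dual (ZMod 2) ((V → ZMod 2) × ZMod 2)) :=
  J.sup fun e => (ZMod 2) ∙ G.edgeVec e

theorem mem_dualCoannihilator_edgeSpan {J : Finset E} {p : (V → ZMod 2) × ZMod 2} :
    p ∈ (G.edgeSpan J).dualCoannihilator ↔ ∀ e ∈ J, G.edgeVec e p = 0 := by
  rw [Submodule.mem_dualCoannihilator]
  constructor
  · intro h e he
    exact h _ (Finset.le_sup (f := fun e => (ZMod 2) ∙ G.edgeVec e) he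
      (Submodule.mem_span_singleton_self _))
  · intro h
    have : G.edgeSpan J ≤ LinearMap.ker (Dual.eval (ZMod 2) _ p) :=
      Finset.sup_le fun e he => by
        rw [Submodule.span_singleton_le_iff_mem]
        exact h e he
    exact fun f hf => this hf

theorem add_eq_zero_iff_zmod_two (a b : ZMod 2) : a + b = 0 ↔ a = b := by
  revert a b
  decide

/-- A set of edges spanning the even-cycle matroid of a connected graph is connected. -/
theorem reach_of_edgeSpan_eq [Fintype E] (hG : ∀ v w, G.reach univ v w) {X : Finset E}
    (hX : G.edgeSpan X = G.edgeSpan univ) (v w : V) : G.reach X v w := by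
  classical
  let x : V → ZMod 2 := fun w => if G.reach X v w then 1 else 0
  have hmem : (x, 0) ∈ (G.edgeSpan X).dualCoannihilator := by
    rw [mem_dualCoannihilator_edgeSpan]
    intro e he
    have : G.reach X v (G.ends e).1 ↔ G.reach X v (G.ends e).2 :=
      ⟨fun h => h.tail (adj_ends he), fun h => h.tail (adj_symm (adj_ends he))⟩
    simp only [edgeVec_apply, mul_zero, add_zero, add_eq_zero_iff_zmod_two, x, this]
  rw [hX, mem_dualCoannihilator_edgeSpan] at hmem
  have := eq_of_reach (x := x) (fun e he => by
    simpa [edgeVec_apply, add_eq_zero_iff_zmod_two] using hmem e he) (hG v w)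
  by_contra h
  simp [x, h, show G.reach X v v from .refl] at this

/-- The components of `J` bound the nullity from above. -/
theorem finrank_dualCoannihilator_edgeSpan_le [Fintype V] (J : Finset E)
    [Fintype (Quot (G.reach J))] :
    finrank (ZMod 2) (G.edgeSpan J).dualCoannihilator ≤ Fintype.card (Quot (G.reach J)) + 1 := by
  let f : ((V → ZMod 2) × ZMod 2) →ₗ[ZMod 2] (Quot (G.reach J) → ZMod 2) × ZMod 2 :=
    (LinearMap.funLeft (ZMod 2) (ZMod 2) Quot.out).prodMap LinearMap.id
  have hinj : Function.Injective (f ∘ₗ (G.edgeSpan J).dualCoannihilator.subtype) := by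
    rw [injective_iff_map_eq_zero]
    rintro ⟨⟨x, s⟩, hp⟩ h0
    rw [mem_dualCoannihilator_edgeSpan] at hp
    have h0' := Prod.ext_iff.1 h0
    have hs : s = 0 := h0'.2
    subst hs
    have hx : ∀ q : Quot (G.reach J), x q.out = 0 := fun q => congrFun h0'.1 q
    have : x = 0 := by
      funext v
      have hv : G.reach J (Quot.mk _ v : Quot (G.reach J)).out v := by
        exact ((reach_equivalence J).quot_mk_eq_iff _ _).1 (Quot.out_eq _)
      rw [← eq_of_reach (x := x) (fun e he => by
        simpa [edgeVec_apply, add_eq_zero_iff_zmod_two] using hp e he) hv, hx]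
      rfl
    subst this
    rfl
  have := LinearMap.finrank_le_finrank_of_injective hinj
  simpa [finrank_prod] using this

theorem finrank_edgeSpan_add [Fintype V] (J : Finset E) :
    finrank (ZMod 2) (G.edgeSpan J) + finrank (ZMod 2) (G.edgeSpan J).dualCoannihilator =
      Fintype.card V + 1 := by
  rw [Subspace.finrank_add_finrank_dualCoannihilator_eq]
  simp [finrank_prod]

/-- In a 4-edge-connected graph, at least twice as many edges as components run between the
components of `J`. -/
theorem two_mul_card_components_le [Fintype E] [DecidableEq E] (J : Finset E)
    [Fintype (Quot (G.reach J))]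
    (h4ec : ∀ S : Finset E, S.card < 4 → ∀ v w : V, G.reach (Finset.univ \ S) v w)
    (hc : 1 < Fintype.card (Quot (G.reach J))) :
    2 * Fintype.card (Quot (G.reach J)) ≤ Jᶜ.card := by
  classical
  let m : V → Quot (G.reach J) := Quot.mk _
  let r : Quot (G.reach J) → E → Prop := fun q e =>
    ¬ (m (G.ends e).1 = q ↔ m (G.ends e).2 = q)
  have hrJ : ∀ q e, r q e → e ∈ Jᶜ := by
    intro q e hr
    rw [Finset.mem_compl]
    intro he
    have : m (G.ends e).1 = m (G.ends e).2 := Quot.sound (.single (adj_ends he))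
    exact hr (by rw [this])
  have hlow : ∀ q : Quot (G.reach J), 4 ≤ (Finset.bipartiteAbove r Jᶜ q).card := by
    intro q
    by_contra! hlt
    obtain ⟨q', hq'⟩ := Fintype.exists_ne_of_one_lt_card hc q
    have := eq_of_reach (x := fun v => m v = q) (fun e he => by
      rw [Finset.mem_sdiff, Finset.mem_bipartiteAbove] at he
      by_contra hne
      have hr : r q e := fun h => hne (propext h)
      exact he.2 ⟨hrJ q e hr, hr⟩) (h4ec _ hlt q.out q'.out)
    exact hq' (by simpa [m, Quot.out_eq] using this)
  have hup : ∀ e ∈ Jᶜ, (Finset.bipartiteBelow r univ e).card ≤ 2 := by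
    intro e _
    refine (Finset.card_le_card (t := {m (G.ends e).1, m (G.ends e).2}) fun q hq => ?_).trans
      Finset.card_le_two
    have hr := ((Finset.mem_bipartiteBelow r).1 hq).2
    simp only [Finset.mem_insert, Finset.mem_singleton]
    by_contra! hne
    exact hr (iff_of_false hne.1.symm hne.2.symm)
  have := Finset.card_mul_le_card_mul r (s := univ) (t := Jᶜ) (m := 4) (n := 2)
    (fun q _ => hlow q) hup
  rw [Finset.card_univ] at this
  omega

/-- A flow-admissible graph cannot be made balanced by deleting a single edge, unless it is
already balanced. -/
theorem edgeVec_eq_zero_of_flowAdmissible [Fintype V] [Fintype E] [DecidableEq V]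
    (hG : G.FlowAdmissible) {e₀ : E}
    {x : V → ZMod 2} (hx : ∀ e ≠ e₀, G.edgeVec e (x, 1) = 0) : G.edgeVec e₀ (x, 1) = 0 := by
  obtain ⟨d, φ, ⟨hd, hφ⟩, hnz⟩ := hG
  let ε : V → ℤ := fun v => if x v = 0 then 1 else -1
  have hsum : ∑ v, ε v * G.vertexSum d φ v = 0 := by simp [hφ]
  have hedge : ∀ e, ∑ v, ε v * ((if (G.ends e).1 = v then (if (d e).1 then φ e else -φ e) else 0) +
      (if (G.ends e).2 = v then (if (d e).2 then φ e else -φ e) else 0)) =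
      ε (G.ends e).1 * (if (d e).1 then φ e else -φ e) +
      ε (G.ends e).2 * (if (d e).2 then φ e else -φ e) := by
    intro e
    simp [mul_add, Finset.sum_add_distrib]
  unfold vertexSum at hsum
  simp_rw [Finset.mul_sum] at hsum
  rw [Finset.sum_comm] at hsum
  simp_rw [hedge] at hsum
  have htwo : ∀ a : ZMod 2, a = 0 ∨ a = 1 := by decide
  rw [Finset.sum_eq_single e₀] at hsum
  · by_contra hne
    have h0 := hnz e₀
    have hd0 := hd e₀
    rw [edgeVec_apply] at hne
    rcases hde : d e₀ with ⟨_ | _, _ | _⟩ <;> rcases hn : G.neg e₀ with _ | _ <;>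
      rcases htwo (x (G.ends e₀).1) with h1 | h1 <;>
      rcases htwo (x (G.ends e₀).2) with h2 | h2 <;>
      simp [hde, hn, h1, h2, ε, CharTwo.add_self_eq_zero] at hsum hne hd0 <;> omega
  · intro e _ he
    have hde := hd e
    have hv := hx e he
    rw [edgeVec_apply] at hv
    rcases hd' : d e with ⟨_ | _, _ | _⟩ <;> rcases hn : G.neg e with _ | _ <;>
      rcases htwo (x (G.ends e).1) with h1 | h1 <;>
      rcases htwo (x (G.ends e).2) with h2 | h2 <;>
      simp [hd', hn, h1, h2, ε, CharTwo.add_self_eq_zero] at hv hde ⊢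
  · simp

/-- The counting condition for two disjoint bases of the even-cycle matroid. -/
theorem two_mul_finrank_edgeSpan_le [Fintype V] [Fintype E] [DecidableEq V] [DecidableEq E]
    [Nonempty V] (hG : G.FlowAdmissible)
    (h4ec : ∀ S : Finset E, S.card < 4 → ∀ v w : V, G.reach (Finset.univ \ S) v w)
    (J : Finset E) :
    2 * finrank (ZMod 2) (G.edgeSpan univ) + J.card ≤
      2 * finrank (ZMod 2) (G.edgeSpan J) + Fintype.card E := by
  classical
  have : Fintype (Quot (G.reach J)) := Fintype.ofFinite _
  have hJ := finrank_edgeSpan_add (G := G) J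
  have hE := finrank_edgeSpan_add (G := G) univ
  have hcJ := finrank_dualCoannihilator_edgeSpan_le (G := G) J
  have hcard := Finset.card_add_card_compl J
  have hle : (G.edgeSpan univ).dualCoannihilator ≤ (G.edgeSpan J).dualCoannihilator :=
    Submodule.dualCoannihilator_anti (Finset.sup_mono (Finset.subset_univ J))
  have hone : (fun _ => 1, 0) ∈ (G.edgeSpan univ).dualCoannihilator := by
    rw [mem_dualCoannihilator_edgeSpan]
    intro e _
    simp [edgeVec_apply, CharTwo.add_self_eq_zero]
  have hE1 : 1 ≤ finrank (ZMod 2) (G.edgeSpan univ).dualCoannihilator := by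
    rw [Submodule.one_le_finrank_iff]
    intro hbot
    rw [hbot, Submodule.mem_bot] at hone
    exact one_ne_zero (congrFun (Prod.ext_iff.1 hone).1 (Classical.arbitrary V))
  rcases lt_or_ge 1 (Fintype.card (Quot (G.reach J))) with hc | hc
  · have := two_mul_card_components_le J h4ec hc
    omega
  by_cases heq : (G.edgeSpan univ).dualCoannihilator = (G.edgeSpan J).dualCoannihilator
  · rw [heq] at hE
    omega
  have : 2 ≤ Jᶜ.card := by
    obtain ⟨⟨x, s⟩, hxJ, hxE⟩ := SetLike.exists_of_lt (hle.lt_of_ne heq)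
    rw [mem_dualCoannihilator_edgeSpan] at hxJ hxE
    have hs : s = 1 := by
      have : s = 0 ∨ s = 1 := by
        clear hxJ hxE
        revert s
        decide
      refine this.resolve_left fun hs => hxE fun e _ => ?_
      subst hs
      have := Fintype.card_le_one_iff_subsingleton.1 hc
      have hr := ((reach_equivalence J).quot_mk_eq_iff _ _).1
        (Subsingleton.elim (Quot.mk (G.reach J) (G.ends e).1) (Quot.mk _ (G.ends e).2))
      have := eq_of_reach (fun e he => by
        simpa [edgeVec_apply, add_eq_zero_iff_zmod_two] using hxJ e he) hr
      simp [edgeVec_apply, this, CharTwo.add_self_eq_zero]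
    subst hs
    by_contra! hlt
    push Not at hxE
    obtain ⟨e₀, -, he₀⟩ := hxE
    have hmem : ∀ e, G.edgeVec e (x, 1) ≠ 0 → e ∈ Jᶜ := fun e he =>
      Finset.mem_compl.2 fun h => he (hxJ e h)
    refine he₀ (edgeVec_eq_zero_of_flowAdmissible hG fun e he => ?_)
    by_contra hne
    exact he (Finset.card_le_one.1 (by omega) e (hmem e hne) e₀ (hmem e₀ he₀))
  omega

theorem even_of_sum_edgeVec_eq_zero [DecidableEq V] {B : Finset E} (hB : ∑ e ∈ B, G.edgeVec e = 0) :
    (∀ v, Even (G.degIn B v)) ∧ Even (G.negEdges B).card := by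
  constructor
  · intro v
    have := LinearMap.congr_fun hB (Pi.single v 1, 0)
    rw [← ZMod.natCast_eq_zero_iff_even]
    simpa [degIn, edgeVec_apply, Pi.single_apply] using this
  · have := LinearMap.congr_fun hB (0, 1)
    rw [← ZMod.natCast_eq_zero_iff_even]
    simpa [negEdges, edgeVec_apply, Finset.sum_boole] using this

end EdgeVectors

end SignedMultigraph

open SignedMultigraph in
/-- Raspaud–Zhu: every flow-admissible 4-edge-connected signed graph has a
nowhere-zero 4-flow. -/
theorem stmt_8 {V E : Type} [Fintype V] [Fintype E] [DecidableEq V] [DecidableEq E]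
    (G : SignedMultigraph V E) (h : G.FlowAdmissible)
    (h4ec : ∀ S : Finset E, S.card < 4 → ∀ v w : V, G.reach (Finset.univ \ S) v w) :
    G.HasNZkFlow 4 := by
  have hconn : ∀ v w, G.reach univ v w := by simpa using h4ec ∅ (by simp)
  have ⟨d, φ, ⟨hd, hφ⟩, _⟩ := h
  rcases isEmpty_or_nonempty V with hV | hV
  · exact ⟨d, φ, ⟨hd, hφ⟩, fun e => hV.elim (G.ends e).1⟩
  have hflow : ∀ X : Finset E, G.edgeSpan X = G.edgeSpan univ →
      G.edgeSpan Xᶜ = G.edgeSpan univ → ∃ ψ : E → ℤ, (∀ e ∈ Xᶜ, |ψ e| = 1) ∧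
        (∀ e, |ψ e| = 1 ∨ ψ e = 0) ∧ ∀ v, G.vertexSum d ψ v = 0 := by
    intro X hX hXc
    obtain ⟨B, hXB, hB⟩ := exists_superset_sum_eq_zero G.edgeVec hX
    obtain ⟨heven, hneg⟩ := even_of_sum_edgeVec_eq_zero hB
    obtain ⟨ψ, h1, h0, hψ⟩ := exists_unit_flow hd heven
      (fun v w => reach_mono hXB (reach_of_edgeSpan_eq hconn hXc v w)) hneg
    exact ⟨ψ, fun e he => h1 e (hXB he), fun e => (em (e ∈ B)).imp (h1 e) (h0 e), hψ⟩
  obtain ⟨X, hX, hXc⟩ := exists_disjoint_spanning G.edgeVec (two_mul_finrank_edgeSpan_le h h4ec)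
  obtain ⟨ψ₁, h₁, h₁', hψ₁⟩ := hflow X hX hXc
  obtain ⟨ψ₂, h₂, h₂', hψ₂⟩ := hflow Xᶜ hXc (by rwa [compl_compl])
  rw [compl_compl] at h₂
  refine ⟨d, fun e => ψ₁ e + 2 * ψ₂ e, ⟨hd, fun v => ?_⟩, fun e => ?_⟩
  · have : G.vertexSum d (fun e => ψ₁ e + 2 * ψ₂ e) v =
        G.vertexSum d ψ₁ v + 2 * G.vertexSum d ψ₂ v := by
      unfold vertexSum
      rw [Finset.mul_sum, ← Finset.sum_add_distrib]
      refine Finset.sum_congr rfl fun e _ => ?_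
      split_ifs <;> ring
    rw [this, hψ₁, hψ₂, mul_zero, add_zero]
  · have key : |ψ₁ e| = 1 ∨ |ψ₂ e| = 1 :=
      (em (e ∈ X)).symm.imp (fun he => h₁ e (Finset.mem_compl.2 he)) (h₂ e)
    have k₁ := h₁' e
    have k₂ := h₂' e
    simp only [abs_eq (zero_le_one' ℤ)] at key k₁ k₂
    rw [abs_pos, abs_lt]
    dsimp only
    omega
end
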